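/- arXiv:math-ph/0506072 — 2 statements merged into one kernel-verified Lean document; each statement's English description precedes it below -/
import Mathlib

section
/- (Embedding in a generating sequence.) Let (F,G) be a generating pair on a domain Ω ⊆ ℝ² (with F, G sufficiently smooth, e.g. continuously differentiable with Hölder-continuous characteristic coefficients), and let Ω₁ be a bounded domain with closure contained in Ω. Then there exists a sequence of generating pairs {(F_m, G_m)}, m ∈ ℤ, on Ω₁ such that (F₀, G₀) = (F, G) restricted to Ω₁ and, for every m ∈ ℤ, (F_{m+1}, G_{m+1}) is a successor of (F_m, G_m), i.e. a_(F_{m+1},G_{m+1}) = a_(F_m,G_m) and b_(F_{m+1},G_{m+1}) = −B_(F_m,G_m) on Ω₁. -/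
open MeasureTheory

/-- Bicomplex numbers: `q = q0 + q1·k` with `q0, q1 : ℂ`, `k² = -1`, `ik = ki`. -/
structure Bicomplex : Type where
  re : ℂ
  im : ℂ

namespace Bicomplex

instance : Zero Bicomplex := ⟨⟨0, 0⟩⟩
instance : One Bicomplex := ⟨⟨1, 0⟩⟩
instance : Add Bicomplex := ⟨fun p q => ⟨p.re + q.re, p.im + q.im⟩⟩
instance : Neg Bicomplex := ⟨fun p => ⟨-p.re, -p.im⟩⟩
instance : Sub Bicomplex := ⟨fun p q => ⟨p.re - q.re, p.im - q.im⟩⟩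
instance : Mul Bicomplex := ⟨fun p q => ⟨p.re * q.re - p.im * q.im, p.re * q.im + p.im * q.re⟩⟩

/-- bicomplex conjugation `q0 + q1·k ↦ q0 - q1·k` -/
def conj (q : Bicomplex) : Bicomplex := ⟨q.re, -q.im⟩

/-- the second imaginary unit `k` -/
def k : Bicomplex := ⟨0, 1⟩

/-- embedding of ℂ into the bicomplex numbers -/
def ofC (z : ℂ) : Bicomplex := ⟨z, 0⟩

/-- bicomplex inverse: `q⁻¹ = q̄/(q0² + q1²)` (junk value if not invertible) -/
noncomputable def inv (q : Bicomplex) : Bicomplex :=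
  ⟨q.re / (q.re ^ 2 + q.im ^ 2), -q.im / (q.re ^ 2 + q.im ^ 2)⟩

/-- the set 𝔖 of bicomplex zero divisors: nonzero `q` with `q·q̄ = q0² + q1² = 0` -/
def zeroDivSet : Set Bicomplex := {q | q ≠ 0 ∧ q.re ^ 2 + q.im ^ 2 = 0}

end Bicomplex

/-- ∂/∂x of a complex-valued function on ℝ² -/
noncomputable def pdx (f : ℝ × ℝ → ℂ) (p : ℝ × ℝ) : ℂ := deriv (fun t => f (t, p.2)) p.1
/-- ∂/∂y of a complex-valued function on ℝ² -/
noncomputable def pdy (f : ℝ × ℝ → ℂ) (p : ℝ × ℝ) : ℂ := deriv (fun t => f (p.1, t)) p.2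
/-- Laplacian Δ = ∂²/∂x² + ∂²/∂y² of a complex-valued function on ℝ² -/
noncomputable def lap (f : ℝ × ℝ → ℂ) (p : ℝ × ℝ) : ℂ := pdx (pdx f) p + pdy (pdy f) p

/-- ∂/∂x of a bicomplex-valued function on ℝ² (componentwise) -/
noncomputable def bpdx (F : ℝ × ℝ → Bicomplex) (p : ℝ × ℝ) : Bicomplex :=
  ⟨pdx (fun q => (F q).re) p, pdx (fun q => (F q).im) p⟩
/-- ∂/∂y of a bicomplex-valued function on ℝ² (componentwise) -/
noncomputable def bpdy (F : ℝ × ℝ → Bicomplex) (p : ℝ × ℝ) : Bicomplex :=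
  ⟨pdy (fun q => (F q).re) p, pdy (fun q => (F q).im) p⟩

/-- `∂̄ = ∂/∂x + k·∂/∂y` -/
noncomputable def dbar (F : ℝ × ℝ → Bicomplex) (p : ℝ × ℝ) : Bicomplex :=
  bpdx F p + Bicomplex.k * bpdy F p

/-- `∂ = ∂/∂x − k·∂/∂y` -/
noncomputable def dz (F : ℝ × ℝ → Bicomplex) (p : ℝ × ℝ) : Bicomplex :=
  bpdx F p - Bicomplex.k * bpdy F p

/-- continuity of a bicomplex-valued function (componentwise) -/
def BContinuousOn (F : ℝ × ℝ → Bicomplex) (Ω : Set (ℝ × ℝ)) : Prop :=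
  ContinuousOn (fun p => (F p).re) Ω ∧ ContinuousOn (fun p => (F p).im) Ω

/-- `C^n` smoothness of a bicomplex-valued function (componentwise) -/
def BContDiffOn (n : ℕ∞) (F : ℝ × ℝ → Bicomplex) (Ω : Set (ℝ × ℝ)) : Prop :=
  ContDiffOn ℝ n (fun p => (F p).re) Ω ∧ ContDiffOn ℝ n (fun p => (F p).im) Ω

/-- characteristic coefficient `a_(F,G)` -/
noncomputable def aCoef (F G : ℝ × ℝ → Bicomplex) (z : ℝ × ℝ) : Bicomplex :=
  -((Bicomplex.conj (F z) * dbar G z - dbar F z * Bicomplex.conj (G z)) *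
    Bicomplex.inv (F z * Bicomplex.conj (G z) - Bicomplex.conj (F z) * G z))
/-- characteristic coefficient `b_(F,G)` -/
noncomputable def bCoef (F G : ℝ × ℝ → Bicomplex) (z : ℝ × ℝ) : Bicomplex :=
  (F z * dbar G z - dbar F z * G z) *
    Bicomplex.inv (F z * Bicomplex.conj (G z) - Bicomplex.conj (F z) * G z)
/-- characteristic coefficient `A_(F,G)` -/
noncomputable def ACoef (F G : ℝ × ℝ → Bicomplex) (z : ℝ × ℝ) : Bicomplex :=
  -((Bicomplex.conj (F z) * dz G z - dz F z * Bicomplex.conj (G z)) *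
    Bicomplex.inv (F z * Bicomplex.conj (G z) - Bicomplex.conj (F z) * G z))
/-- characteristic coefficient `B_(F,G)` -/
noncomputable def BCoef (F G : ℝ × ℝ → Bicomplex) (z : ℝ × ℝ) : Bicomplex :=
  (F z * dz G z - dz F z * G z) *
    Bicomplex.inv (F z * Bicomplex.conj (G z) - Bicomplex.conj (F z) * G z)

/-- `(F,G)` is a generating pair on `Ω` -/
def IsGeneratingPair (F G : ℝ × ℝ → Bicomplex) (Ω : Set (ℝ × ℝ)) : Prop :=
  BContDiffOn 1 F Ω ∧ BContDiffOn 1 G Ω ∧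
    ∀ z ∈ Ω, (Bicomplex.conj (F z) * G z).im ≠ 0

/-- A radial majorant on the plane, integrable at the origin and at infinity. -/
noncomputable def radialMajorant (α r : ℝ) : ℝ := if r ≤ 1 then r ^ (α - 2) else r ^ (α - 3)

theorem radialMajorant_nonneg (α : ℝ) {r : ℝ} (hr : 0 ≤ r) : 0 ≤ radialMajorant α r := by
  unfold radialMajorant
  split_ifs <;> positivity

theorem integrable_radialMajorant {α : ℝ} (h0 : 0 < α) (h1 : α < 1) :
    Integrable (fun s : ℂ => radialMajorant α ‖s‖) := by
  rw [integrable_fun_norm_addHaar volume (f := radialMajorant α)]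
  simp only [Complex.finrank_real_complex, Nat.add_one_sub_one, pow_one, smul_eq_mul]
  rw [← Set.Ioc_union_Ioi_eq_Ioi (zero_le_one' ℝ)]
  refine IntegrableOn.union ?_ ?_
  · have h : IntegrableOn (fun r : ℝ => r ^ (α - 1)) (Set.Ioc 0 1) := by
      rw [← intervalIntegrable_iff_integrableOn_Ioc_of_le zero_le_one]
      exact intervalIntegral.intervalIntegrable_rpow' (by linarith)
    refine h.congr_fun (fun r hr => ?_) measurableSet_Ioc
    simp only [radialMajorant, if_pos hr.2]
    rw [← Real.rpow_one_add' hr.1.le (by linarith)]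
    ring_nf
  · have h : IntegrableOn (fun r : ℝ => r ^ (α - 2)) (Set.Ioi 1) :=
      integrableOn_Ioi_rpow_of_lt (by linarith) one_pos
    refine h.congr_fun (fun r hr => ?_) measurableSet_Ioi
    have hr' : (1 : ℝ) < r := hr
    simp only [radialMajorant, if_neg (not_le.2 hr')]
    rw [← Real.rpow_one_add' (by linarith) (by linarith)]
    ring_nf

theorem rpow_mul_inv_le_radialMajorant {α x y : ℝ} (h0 : 0 < α) (h1 : α < 1) (hx : 0 ≤ x)
    (hy : 0 ≤ y) (hxy : 1 ≤ x + y) :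
    x ^ (α - 2) * y⁻¹ ≤ 4 * (radialMajorant α x + radialMajorant α y) := by
  have nx := radialMajorant_nonneg α hx
  have ny := radialMajorant_nonneg α hy
  rcases le_total x y with h | h
  · have hy2 : y⁻¹ ≤ 2 := by
      rw [inv_le_comm₀ (by linarith) (by norm_num)]
      linarith
    have hxp : 0 ≤ x ^ (α - 2) := by positivity
    suffices x ^ (α - 2) * y⁻¹ ≤ 2 * radialMajorant α x by linarith
    unfold radialMajorant
    split_ifs with hx1
    · nlinarith
    · have hx0 : 0 < x := by linarith
      have : x ^ (α - 3) = x ^ (α - 2) * x⁻¹ := by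
        rw [← Real.rpow_neg_one x, ← Real.rpow_add hx0]
        ring_nf
      rw [this]
      have : y⁻¹ ≤ x⁻¹ := inv_anti₀ hx0 h
      have : 0 ≤ x⁻¹ := by positivity
      nlinarith
  · rcases hy.eq_or_lt with rfl | hy0
    · simp only [inv_zero, mul_zero]
      linarith
    have hyi : 0 < y⁻¹ := by positivity
    suffices x ^ (α - 2) * y⁻¹ ≤ 4 * radialMajorant α y by linarith
    unfold radialMajorant
    split_ifs with hy1
    · have e1 : x ^ (α - 2) ≤ 4 := by
        calc x ^ (α - 2) ≤ (1 / 2 : ℝ) ^ (α - 2) :=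
              Real.rpow_le_rpow_of_nonpos (by norm_num) (by linarith) (by linarith)
          _ ≤ (1 / 2 : ℝ) ^ (-2 : ℝ) :=
              Real.rpow_le_rpow_of_exponent_ge (by norm_num) (by norm_num) (by linarith)
          _ = 4 := by
              rw [Real.rpow_neg (by norm_num)]
              norm_num
      have e2 : y⁻¹ ≤ y ^ (α - 2) := by
        rw [← Real.rpow_neg_one]
        exact Real.rpow_le_rpow_of_exponent_ge hy0 hy1 (by linarith)
      nlinarith
    · have : y ^ (α - 3) = y ^ (α - 2) * y⁻¹ := by
        rw [← Real.rpow_neg_one y, ← Real.rpow_add hy0]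
        ring_nf
      rw [this]
      have e1 : x ^ (α - 2) ≤ y ^ (α - 2) := Real.rpow_le_rpow_of_nonpos hy0 h (by linarith)
      have : 0 ≤ y ^ (α - 2) := by positivity
      nlinarith

theorem exists_integral_rpow_mul_inv_le {α : ℝ} (h0 : 0 < α) (h1 : α < 1) :
    ∃ J : ℝ, 0 ≤ J ∧ ∀ t : ℂ, t ≠ 0 →
      Integrable (fun s : ℂ => ‖s‖ ^ (α - 2) * ‖s - t‖⁻¹) ∧
      ∫ s : ℂ, ‖s‖ ^ (α - 2) * ‖s - t‖⁻¹ ≤ J * ‖t‖ ^ (α - 1) := by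
  set I : ℝ := ∫ s : ℂ, radialMajorant α ‖s‖ with hI
  have hI0 : 0 ≤ I := integral_nonneg fun s => radialMajorant_nonneg α (norm_nonneg s)
  have hInt := integrable_radialMajorant h0 h1
  refine ⟨8 * I, by positivity, fun t ht => ?_⟩
  have hτ : 0 < ‖t‖ := norm_pos_iff.2 ht
  set k : ℂ → ℝ := fun s => radialMajorant α ‖(‖t‖⁻¹ : ℝ) • s‖ with hk
  have kint : Integrable k := hInt.comp_smul (inv_ne_zero hτ.ne')
  have kval : ∫ s, k s = ‖t‖ ^ 2 * I := by
    have := Measure.integral_comp_inv_smul_of_nonneg (volume : Measure ℂ)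
      (fun s : ℂ => radialMajorant α ‖s‖) hτ.le
    simpa [hk] using this
  have kint' : Integrable (fun s => k (s - t)) := kint.comp_sub_right t
  have kval' : ∫ s, k (s - t) = ‖t‖ ^ 2 * I := by
    rw [← kval]
    exact integral_sub_right_eq_self k t
  have bound : ∀ s : ℂ, ‖s‖ ^ (α - 2) * ‖s - t‖⁻¹ ≤
      4 * ‖t‖ ^ (α - 3) * (k s + k (s - t)) := by
    intro s
    have hx : ‖(‖t‖⁻¹ : ℝ) • s‖ = ‖s‖ / ‖t‖ := by
      rw [norm_smul, norm_inv, norm_norm, div_eq_inv_mul]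
    have hy : ‖(‖t‖⁻¹ : ℝ) • (s - t)‖ = ‖s - t‖ / ‖t‖ := by
      rw [norm_smul, norm_inv, norm_norm, div_eq_inv_mul]
    have key := rpow_mul_inv_le_radialMajorant (x := ‖s‖ / ‖t‖) (y := ‖s - t‖ / ‖t‖) h0 h1
      (by positivity) (by positivity) (by
        rw [← add_div, le_div_iff₀ hτ, one_mul]
        simpa using norm_sub_le s (s - t))
    simp only [hk, hx, hy]
    have e : ‖s‖ ^ (α - 2) * ‖s - t‖⁻¹ =
        ‖t‖ ^ (α - 3) * ((‖s‖ / ‖t‖) ^ (α - 2) * (‖s - t‖ / ‖t‖)⁻¹) := by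
      rw [Real.div_rpow (norm_nonneg _) hτ.le, show α - 3 = (α - 2) - 1 by ring,
        Real.rpow_sub_one hτ.ne']
      have := (Real.rpow_pos_of_pos hτ (α - 2)).ne'
      field_simp
    rw [e, mul_comm 4, mul_assoc]
    exact mul_le_mul_of_nonneg_left key (by positivity)
  have dom : Integrable (fun s => 4 * ‖t‖ ^ (α - 3) * (k s + k (s - t))) :=
    (kint.add kint').const_mul _
  have meas : Measurable (fun s : ℂ => ‖s‖ ^ (α - 2) * ‖s - t‖⁻¹) := by fun_prop
  have hi : Integrable (fun s : ℂ => ‖s‖ ^ (α - 2) * ‖s - t‖⁻¹) := by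
    refine dom.mono' meas.aestronglyMeasurable (Filter.Eventually.of_forall fun s => ?_)
    rw [Real.norm_of_nonneg (by positivity)]
    exact bound s
  refine ⟨hi, (integral_mono hi dom bound).trans_eq ?_⟩
  rw [integral_const_mul, integral_add kint kint', kval, kval']
  have : ‖t‖ ^ (α - 1) = ‖t‖ ^ (α - 3) * ‖t‖ ^ 2 := by
    rw [← Real.rpow_natCast, ← Real.rpow_add hτ]
    norm_num
    ring_nf
  rw [this]
  ring

/-- The inverse of `∂/∂x + i ∂/∂y` on compactly supported functions. -/
noncomputable def cauchyTransform (f : ℂ → ℂ) (z : ℂ) : ℂ :=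
  (2 * Real.pi : ℂ)⁻¹ * ∫ w, (z - w)⁻¹ * f w

/-- Continuous functions bounded by `A` and vanishing outside the disk of radius `R`. -/
structure BddSupp (R A : ℝ) (f : ℂ → ℂ) : Prop where
  continuous : Continuous f
  norm_le : ∀ x, ‖f x‖ ≤ A
  eq_zero : ∀ x, R < ‖x‖ → f x = 0

namespace BddSupp

variable {R A : ℝ} {f g : ℂ → ℂ}

theorem nonneg (hf : BddSupp R A f) : 0 ≤ A := (norm_nonneg _).trans (hf.norm_le 0)

theorem norm_le_indicator (hf : BddSupp R A f) (w : ℂ) :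
    ‖f w‖ ≤ A * (Metric.closedBall (0 : ℂ) R).indicator 1 w := by
  by_cases hw : w ∈ Metric.closedBall (0 : ℂ) R
  · simpa [hw] using hf.norm_le w
  · have : R < ‖w‖ := by simpa using hw
    simp [hf.eq_zero w this, hw]

theorem unimodular_mul (hf : BddSupp R A f) {e : ℂ → ℂ} (he : Continuous e)
    (hn : ∀ x, ‖e x‖ = 1) : BddSupp R A (fun x => e x * f x) where
  continuous := he.mul hf.continuous
  norm_le x := by simpa [hn] using hf.norm_le x
  eq_zero x hx := by simp [hf.eq_zero x hx]

end BddSupp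

theorem integrable_indicator_closedBall (R : ℝ) :
    Integrable ((Metric.closedBall (0 : ℂ) R).indicator (1 : ℂ → ℝ)) :=
  (integrable_indicator_iff Metric.isClosed_closedBall.measurableSet).2
    (integrableOn_const (measure_closedBall_lt_top).ne)

theorem integrable_radialMajorant_sub {α : ℝ} (h0 : 0 < α) (h1 : α < 1) (z : ℂ) :
    Integrable (fun w : ℂ => radialMajorant α ‖z - w‖) :=
  (integrable_radialMajorant h0 h1).comp_sub_left z

theorem integral_radialMajorant_sub (α : ℝ) (z : ℂ) :
    ∫ w : ℂ, radialMajorant α ‖z - w‖ = ∫ w : ℂ, radialMajorant α ‖w‖ :=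
  integral_sub_left_eq_self (fun w : ℂ => radialMajorant α ‖w‖) volume z

theorem inv_mul_indicator_le (R : ℝ) (s w : ℂ) :
    ‖s‖⁻¹ * (Metric.closedBall (0 : ℂ) R).indicator 1 w ≤
      radialMajorant (1 / 2) ‖s‖ + (Metric.closedBall (0 : ℂ) R).indicator 1 w := by
  have h : ‖s‖⁻¹ ≤ radialMajorant (1 / 2) ‖s‖ + 1 := by
    rcases eq_or_ne s 0 with rfl | hs
    · have := radialMajorant_nonneg (1 / 2) (norm_nonneg (0 : ℂ))
      simp only [norm_zero, inv_zero] at this ⊢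
      linarith
    have hs0 := norm_pos_iff.2 hs
    by_cases h1 : ‖s‖ ≤ 1
    · have : ‖s‖⁻¹ ≤ ‖s‖ ^ ((1 / 2 : ℝ) - 2) := by
        rw [← Real.rpow_neg_one]
        exact Real.rpow_le_rpow_of_exponent_ge hs0 h1 (by norm_num)
      rw [radialMajorant, if_pos h1]
      linarith
    · have := radialMajorant_nonneg (1 / 2) (norm_nonneg s)
      have := inv_le_one_of_one_le₀ (not_le.1 h1).le
      linarith
  have := radialMajorant_nonneg (1 / 2) (norm_nonneg s)
  by_cases hw : w ∈ Metric.closedBall (0 : ℂ) R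
  · simpa [hw] using h
  · simpa [hw] using this

theorem BddSupp.norm_kernel_mul_le {R A : ℝ} {f : ℂ → ℂ} (hf : BddSupp R A f) (z w : ℂ) :
    ‖(z - w)⁻¹ * f w‖ ≤ A * (radialMajorant (1 / 2) ‖z - w‖ +
      (Metric.closedBall (0 : ℂ) R).indicator 1 w) := by
  rw [norm_mul, norm_inv]
  calc ‖z - w‖⁻¹ * ‖f w‖
      ≤ ‖z - w‖⁻¹ * (A * (Metric.closedBall (0 : ℂ) R).indicator 1 w) := by
        gcongr
        exact hf.norm_le_indicator w
    _ = A * (‖z - w‖⁻¹ * (Metric.closedBall (0 : ℂ) R).indicator 1 w) := by ring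
    _ ≤ _ := mul_le_mul_of_nonneg_left (inv_mul_indicator_le R _ w) hf.nonneg

theorem BddSupp.integrable_kernel_mul {R A : ℝ} {f : ℂ → ℂ} (hf : BddSupp R A f) (z : ℂ) :
    Integrable (fun w => (z - w)⁻¹ * f w) := by
  have hm : Measurable f := hf.continuous.measurable
  refine (((integrable_radialMajorant_sub (by norm_num) (by norm_num) z).add
    (integrable_indicator_closedBall R)).const_mul A).mono'
    (by fun_prop : Measurable fun w => (z - w)⁻¹ * f w).aestronglyMeasurable
    (Filter.Eventually.of_forall fun w => hf.norm_kernel_mul_le z w)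

theorem cauchyTransform_sub {R A R' A' : ℝ} {f g : ℂ → ℂ} (hf : BddSupp R A f)
    (hg : BddSupp R' A' g) (z : ℂ) :
    cauchyTransform (fun w => f w - g w) z = cauchyTransform f z - cauchyTransform g z := by
  simp only [cauchyTransform, mul_sub]
  rw [integral_sub (hf.integrable_kernel_mul z) (hg.integrable_kernel_mul z), mul_sub]

theorem norm_two_pi_inv_le : ‖(2 * Real.pi : ℂ)⁻¹‖ ≤ 1 := by
  rw [norm_inv]
  apply inv_le_one_of_one_le₀
  rw [norm_mul, Complex.norm_real, Real.norm_of_nonneg Real.pi_pos.le, Complex.norm_ofNat]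
  linarith [Real.pi_gt_three]

theorem exists_norm_cauchyTransform_le (R : ℝ) :
    ∃ C : ℝ, 0 ≤ C ∧ ∀ A f, BddSupp R A f → ∀ z, ‖cauchyTransform f z‖ ≤ C * A := by
  have i1 := integrable_radialMajorant (α := 1 / 2) (by norm_num) (by norm_num)
  refine ⟨(∫ w : ℂ, radialMajorant (1 / 2) ‖w‖) +
    ∫ w : ℂ, (Metric.closedBall (0 : ℂ) R).indicator (1 : ℂ → ℝ) w, ?_, fun A f hf z => ?_⟩
  · exact add_nonneg (integral_nonneg fun s => radialMajorant_nonneg _ (norm_nonneg s))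
      (integral_nonneg fun s => Set.indicator_nonneg (fun _ _ => by simp) s)
  · have j1 := integrable_radialMajorant_sub (α := 1 / 2) (by norm_num) (by norm_num) z
    have j2 := integrable_indicator_closedBall R
    calc ‖cauchyTransform f z‖ ≤ 1 * ‖∫ w, (z - w)⁻¹ * f w‖ := by
          rw [cauchyTransform, norm_mul]
          gcongr
          exact norm_two_pi_inv_le
      _ ≤ ∫ w, A * (radialMajorant (1 / 2) ‖z - w‖ +
            (Metric.closedBall (0 : ℂ) R).indicator 1 w) := by
          rw [one_mul]
          exact norm_integral_le_of_norm_le ((j1.add j2).const_mul A)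
            (Filter.Eventually.of_forall fun w => hf.norm_kernel_mul_le z w)
      _ = _ := by
          rw [integral_const_mul, integral_add j1 j2, integral_radialMajorant_sub]
          ring

theorem exists_norm_cauchyTransform_sub_le (R : ℝ) :
    ∃ C : ℝ, 0 ≤ C ∧ ∀ A f, BddSupp R A f → ∀ z z',
      ‖cauchyTransform f z - cauchyTransform f z'‖ ≤ C * A * ‖z - z'‖ ^ (1 / 2 : ℝ) := by
  obtain ⟨C₀, hC₀, hb⟩ := exists_norm_cauchyTransform_le R
  obtain ⟨J, hJ, hJb⟩ := exists_integral_rpow_mul_inv_le (α := 1 / 2) (by norm_num) (by norm_num)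
  set I₁ : ℝ := ∫ w : ℂ, radialMajorant (1 / 2) ‖w‖ with hI₁
  set I₂ : ℝ := ∫ w : ℂ, (Metric.closedBall (0 : ℂ) R).indicator (1 : ℂ → ℝ) w with hI₂
  have hI₁0 : 0 ≤ I₁ := integral_nonneg fun s => radialMajorant_nonneg _ (norm_nonneg s)
  have hI₂0 : 0 ≤ I₂ := integral_nonneg fun s => Set.indicator_nonneg (fun _ _ => by simp) s
  refine ⟨2 * C₀ + (J + I₁ + I₂), by positivity, fun A f hf z z' => ?_⟩
  have hA := hf.nonneg
  rcases eq_or_ne z z' with rfl | hz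
  · simp
  set τ : ℂ := z - z' with hτ
  have hτ0 : τ ≠ 0 := sub_ne_zero.2 hz
  have hτn : 0 < ‖τ‖ := norm_pos_iff.2 hτ0
  rcases le_total 1 ‖τ‖ with h1 | h1
  · have : (1 : ℝ) ≤ ‖τ‖ ^ (1 / 2 : ℝ) := Real.one_le_rpow h1 (by norm_num)
    calc ‖cauchyTransform f z - cauchyTransform f z'‖ ≤ C₀ * A + C₀ * A :=
          (norm_sub_le _ _).trans (add_le_add (hb A f hf z) (hb A f hf z'))
      _ = 2 * C₀ * A * 1 := by ring
      _ ≤ (2 * C₀ + (J + I₁ + I₂)) * A * ‖τ‖ ^ (1 / 2 : ℝ) := by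
          gcongr
          linarith
  · obtain ⟨hi, hv⟩ := hJb τ hτ0
    have hi' : Integrable (fun w : ℂ => ‖z - w‖ ^ ((1 / 2 : ℝ) - 2) * ‖z - w - τ‖⁻¹) :=
      hi.comp_sub_left z
    have hv' : ∫ w : ℂ, ‖z - w‖ ^ ((1 / 2 : ℝ) - 2) * ‖z - w - τ‖⁻¹ ≤
        J * ‖τ‖ ^ ((1 / 2 : ℝ) - 1) := by
      rwa [integral_sub_left_eq_self
        (fun s : ℂ => ‖s‖ ^ ((1 / 2 : ℝ) - 2) * ‖s - τ‖⁻¹) volume z]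
    have j1 := integrable_radialMajorant_sub (α := 1 / 2) (by norm_num) (by norm_num) z'
    have j2 := integrable_indicator_closedBall R
    have hae : ∀ᵐ w : ℂ, ‖(z - w)⁻¹ * f w - (z' - w)⁻¹ * f w‖ ≤
        A * ‖τ‖ * (‖z - w‖ ^ ((1 / 2 : ℝ) - 2) * ‖z - w - τ‖⁻¹ +
          (radialMajorant (1 / 2) ‖z' - w‖ +
            (Metric.closedBall (0 : ℂ) R).indicator 1 w)) := by
      filter_upwards [Measure.ae_ne volume z, Measure.ae_ne volume z'] with w hw hw'
      have n1 : z - w ≠ 0 := sub_ne_zero.2 hw.symm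
      have n2 : z' - w ≠ 0 := sub_ne_zero.2 hw'.symm
      have p1 := norm_pos_iff.2 n1
      have p2 := norm_pos_iff.2 n2
      have e : (z - w)⁻¹ * f w - (z' - w)⁻¹ * f w = -τ * ((z - w)⁻¹ * (z' - w)⁻¹) * f w := by
        rw [hτ]
        field_simp
        ring
      have e' : z - w - τ = z' - w := by rw [hτ]; ring
      rw [e, e', norm_mul, norm_mul, norm_mul, norm_neg, norm_inv, norm_inv]
      set χ : ℝ := (Metric.closedBall (0 : ℂ) R).indicator 1 w with hχ
      have hχ0 : 0 ≤ χ := Set.indicator_nonneg (fun _ _ => by simp) w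
      have hχ1 : χ ≤ 1 := Set.indicator_le' (fun _ _ => le_rfl) (fun _ _ => by simp) w
      have k1 := inv_mul_indicator_le R (z' - w) w
      have k2 : ‖z - w‖⁻¹ ≤ ‖z - w‖ ^ ((1 / 2 : ℝ) - 2) + 1 := by
        have : 0 ≤ ‖z - w‖ ^ ((1 / 2 : ℝ) - 2) := by positivity
        rcases le_total ‖z - w‖ 1 with h | h
        · have : ‖z - w‖⁻¹ ≤ ‖z - w‖ ^ ((1 / 2 : ℝ) - 2) := by
            rw [← Real.rpow_neg_one]
            exact Real.rpow_le_rpow_of_exponent_ge p1 h (by norm_num)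
          linarith
        · linarith [inv_le_one_of_one_le₀ h]
      calc ‖τ‖ * (‖z - w‖⁻¹ * ‖z' - w‖⁻¹) * ‖f w‖
          ≤ ‖τ‖ * ((‖z - w‖ ^ ((1 / 2 : ℝ) - 2) + 1) * ‖z' - w‖⁻¹) * (A * χ) := by
            gcongr
            exact hf.norm_le_indicator w
        _ = A * ‖τ‖ * (‖z - w‖ ^ ((1 / 2 : ℝ) - 2) * ‖z' - w‖⁻¹ * χ + ‖z' - w‖⁻¹ * χ) := by ring
        _ ≤ _ := mul_le_mul_of_nonneg_left
            (add_le_add (mul_le_of_le_one_right (by positivity) hχ1) k1) (by positivity)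
    have hτs : ‖τ‖ ≤ ‖τ‖ ^ (1 / 2 : ℝ) := by
      conv_lhs => rw [← Real.rpow_one ‖τ‖]
      exact Real.rpow_le_rpow_of_exponent_ge hτn h1 (by norm_num)
    calc ‖cauchyTransform f z - cauchyTransform f z'‖
        ≤ 1 * ‖∫ w, ((z - w)⁻¹ * f w - (z' - w)⁻¹ * f w)‖ := by
          rw [cauchyTransform, cauchyTransform, ← mul_sub, norm_mul,
            integral_sub (hf.integrable_kernel_mul z) (hf.integrable_kernel_mul z')]
          gcongr
          exact norm_two_pi_inv_le
      _ ≤ ∫ w, A * ‖τ‖ * (‖z - w‖ ^ ((1 / 2 : ℝ) - 2) * ‖z - w - τ‖⁻¹ +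
          (radialMajorant (1 / 2) ‖z' - w‖ +
            (Metric.closedBall (0 : ℂ) R).indicator 1 w)) := by
          rw [one_mul]
          exact norm_integral_le_of_norm_le ((hi'.add (j1.add j2)).const_mul _) hae
      _ = A * ‖τ‖ * ((∫ w : ℂ, ‖z - w‖ ^ ((1 / 2 : ℝ) - 2) * ‖z - w - τ‖⁻¹) + (I₁ + I₂)) := by
          rw [integral_const_mul]
          congr 1
          have := integral_add hi' (j1.add j2)
          simp only [Pi.add_apply] at this
          rw [this, integral_add j1 j2, integral_radialMajorant_sub]
      _ ≤ A * ‖τ‖ * (J * ‖τ‖ ^ ((1 / 2 : ℝ) - 1) + (I₁ + I₂)) := by gcongr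
      _ = A * J * (‖τ‖ * ‖τ‖ ^ ((1 / 2 : ℝ) - 1)) + A * (I₁ + I₂) * ‖τ‖ := by ring
      _ = A * J * ‖τ‖ ^ (1 / 2 : ℝ) + A * (I₁ + I₂) * ‖τ‖ := by
          rw [Real.rpow_sub_one hτn.ne', mul_div_cancel₀ _ hτn.ne']
      _ ≤ A * J * ‖τ‖ ^ (1 / 2 : ℝ) + A * (I₁ + I₂) * ‖τ‖ ^ (1 / 2 : ℝ) := by gcongr
      _ ≤ (2 * C₀ + (J + I₁ + I₂)) * A * ‖τ‖ ^ (1 / 2 : ℝ) := by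
          have : 0 ≤ 2 * C₀ * A * ‖τ‖ ^ (1 / 2 : ℝ) := by positivity
          linarith

theorem circleAverage_inv_sub_of_lt {z : ℂ} {r : ℝ} (hr : 0 < r) (h : r < ‖z‖) :
    Real.circleAverage (fun w => (z - w)⁻¹) 0 r = z⁻¹ := by
  have hne : ∀ w ∈ Metric.closedBall (0 : ℂ) r, z - w ≠ 0 := by
    intro w hw h0
    rw [sub_eq_zero.1 h0] at h
    simp only [mem_closedBall_zero_iff] at hw
    linarith
  have hd : DifferentiableOn ℂ (fun w => (z - w)⁻¹) (Metric.closedBall 0 r) :=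
    DifferentiableOn.fun_inv (by fun_prop) hne
  have hd' : DiffContOnCl ℂ (fun w => (z - w)⁻¹) (Metric.ball 0 |r|) := by
    rw [abs_of_pos hr]
    exact hd.diffContOnCl_ball subset_rfl
  simpa using hd'.circleAverage

theorem circleAverage_inv_sub_of_gt {z : ℂ} {r : ℝ} (h : ‖z‖ < r) :
    Real.circleAverage (fun w => (z - w)⁻¹) 0 r = 0 := by
  have hr : 0 < r := (norm_nonneg z).trans_lt h
  have hne : ∀ w ∈ Metric.closedBall (0 : ℂ) r, (starRingEnd ℂ z) * w - (r : ℂ) ^ 2 ≠ 0 := by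
    intro w hw h0
    simp only [mem_closedBall_zero_iff] at hw
    have h2 := congrArg norm (sub_eq_zero.1 h0)
    rw [norm_mul, norm_pow, Complex.norm_real, Real.norm_of_nonneg hr.le, RCLike.norm_conj] at h2
    nlinarith [norm_nonneg z, norm_nonneg w]
  have hd : DifferentiableOn ℂ (fun w => w * ((starRingEnd ℂ z) * w - (r : ℂ) ^ 2)⁻¹)
      (Metric.closedBall 0 r) :=
    DifferentiableOn.mul (by fun_prop) (DifferentiableOn.fun_inv (by fun_prop) hne)
  have hd' : DiffContOnCl ℂ (fun w => w * ((starRingEnd ℂ z) * w - (r : ℂ) ^ 2)⁻¹)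
      (Metric.ball 0 |r|) := by
    rw [abs_of_pos hr]
    exact hd.diffContOnCl_ball subset_rfl
  have h0 := hd'.circleAverage
  have hi : CircleIntegrable (fun w => (z - w)⁻¹) 0 r := by
    refine ContinuousOn.circleIntegrable hr.le (ContinuousOn.inv₀ (by fun_prop) ?_)
    intro w hw h0
    rw [sub_eq_zero.1 h0] at h
    simp only [mem_sphere_zero_iff_norm] at hw
    linarith
  have hc := (Complex.conjCLE : ℂ →L[ℝ] ℂ).circleAverage_comp_comm hi
  have he : Real.circleAverage ((Complex.conjCLE : ℂ →L[ℝ] ℂ) ∘ fun w => (z - w)⁻¹) 0 r =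
      Real.circleAverage (fun w => w * ((starRingEnd ℂ z) * w - (r : ℂ) ^ 2)⁻¹) 0 r := by
    refine Real.circleAverage_congr_sphere fun w hw => ?_
    rw [abs_of_pos hr, mem_sphere_zero_iff_norm] at hw
    have hw0 : w ≠ 0 := by
      rw [← norm_pos_iff, hw]
      exact hr
    have hww : (starRingEnd ℂ w) * w = (r : ℂ) ^ 2 := by
      rw [mul_comm, Complex.mul_conj, Complex.normSq_eq_norm_sq, hw]
      push_cast
      rfl
    simp only [ContinuousLinearEquiv.coe_coe, Function.comp_apply, Complex.conjCLE_apply,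
      map_inv₀, map_sub]
    rw [← hww, ← sub_mul, mul_inv]
    field_simp
  rw [he, h0] at hc
  simpa using hc.symm

theorem integral_circle_eq_circleAverage (f : ℂ → ℂ) (r : ℝ) :
    ∫ θ in Set.Ioo (-Real.pi) Real.pi, f (r * (Real.cos θ + Real.sin θ * Complex.I)) =
      2 * Real.pi * Real.circleAverage f 0 r := by
  have h1 : ∀ θ : ℝ, (r * (Real.cos θ + Real.sin θ * Complex.I) : ℂ) = circleMap 0 r θ := by
    intro θ
    rw [circleMap_zero, Complex.exp_mul_I]
    push_cast
    rfl
  simp only [h1]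
  rw [← integral_Ioc_eq_integral_Ioo, ← intervalIntegral.integral_of_le (by linarith [Real.pi_pos])]
  have hp : (fun θ => f (circleMap 0 r θ)).Periodic (2 * Real.pi) :=
    fun x => by simp [periodic_circleMap 0 r x]
  have := hp.intervalIntegral_add_eq (-Real.pi) 0
  rw [show -Real.pi + 2 * Real.pi = Real.pi by ring, zero_add] at this
  rw [this, Real.circleAverage_def, Complex.real_smul]
  push_cast
  rw [← mul_assoc, mul_inv_cancel₀, one_mul]
  simp [Real.pi_ne_zero]

theorem Complex.integrable_comp_polarCoord_symm {f : ℂ → ℂ} (hm : Measurable f)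
    (hf : Integrable f) :
    IntegrableOn (fun p : ℝ × ℝ => p.1 • f (Complex.polarCoord.symm p)) polarCoord.target := by
  have hs : Measurable fun p : ℝ × ℝ => Complex.polarCoord.symm p := by
    simp only [Complex.polarCoord_symm_apply]
    fun_prop
  refine ⟨(measurable_fst.smul (hm.comp hs)).aestronglyMeasurable, ?_⟩
  have h := Complex.lintegral_comp_polarCoord_symm fun w => ‖f w‖ₑ
  have h2 := hf.2
  rw [HasFiniteIntegral, ← h] at h2
  rw [HasFiniteIntegral]
  refine lt_of_eq_of_lt (setLIntegral_congr_fun ?_ fun p hp => ?_) h2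
  · exact polarCoord.open_target.measurableSet
  · have hp1 : 0 < p.1 := hp.1
    simp only [enorm_smul, smul_eq_mul, Real.enorm_eq_ofReal hp1.le]

theorem integrable_inv_sub_indicator (z : ℂ) (R : ℝ) :
    Integrable ((Metric.ball (0 : ℂ) R).indicator fun w => (z - w)⁻¹) := by
  refine ((integrable_radialMajorant_sub (α := 1 / 2) (by norm_num) (by norm_num) z).add
    (integrable_indicator_closedBall R)).mono'
    ((by fun_prop : Measurable fun w : ℂ => (z - w)⁻¹).indicator
      Metric.isOpen_ball.measurableSet).aestronglyMeasurable
    (Filter.Eventually.of_forall fun w => ?_)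
  have h := inv_mul_indicator_le R (z - w) w
  by_cases hw : w ∈ Metric.ball (0 : ℂ) R
  · simpa [hw, Metric.ball_subset_closedBall hw] using h
  · simp only [hw, not_false_eq_true, Set.indicator_of_notMem, norm_zero]
    exact add_nonneg (radialMajorant_nonneg _ (norm_nonneg _))
      (Set.indicator_nonneg (fun _ _ => by simp) w)

theorem setIntegral_ball_inv_sub {z : ℂ} {R : ℝ} (h : ‖z‖ < R) :
    ∫ w in Metric.ball (0 : ℂ) R, (z - w)⁻¹ = Real.pi * (starRingEnd ℂ z) := by
  set g := (Metric.ball (0 : ℂ) R).indicator fun w => (z - w)⁻¹ with hg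
  have hgm : Measurable g := (by fun_prop : Measurable fun w : ℂ => (z - w)⁻¹).indicator
      Metric.isOpen_ball.measurableSet
  rw [← integral_indicator Metric.isOpen_ball.measurableSet, ← hg,
    ← Complex.integral_comp_polarCoord_symm]
  have hInt := Complex.integrable_comp_polarCoord_symm hgm (integrable_inv_sub_indicator z R)
  rw [polarCoord_target] at hInt ⊢
  rw [Measure.volume_eq_prod] at hInt ⊢
  rw [setIntegral_prod _ hInt]
  have inner : ∀ᵐ r ∂(volume.restrict (Set.Ioi (0 : ℝ))),
      ∫ θ in Set.Ioo (-Real.pi) Real.pi, (r, θ).1 • g (Complex.polarCoord.symm (r, θ)) =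
      (Set.Ioc 0 ‖z‖).indicator (fun r : ℝ => (2 * Real.pi * z⁻¹) * (r : ℂ)) r := by
    have hne : ∀ᵐ r : ℝ, r ≠ ‖z‖ := Measure.ae_ne volume ‖z‖
    filter_upwards [ae_restrict_mem measurableSet_Ioi, ae_restrict_of_ae hne] with r hr hrz
    have hr0 : (0 : ℝ) < r := hr
    simp only [Complex.polarCoord_symm_apply]
    rw [integral_smul, integral_circle_eq_circleAverage g r]
    have hgr : r < R → Real.circleAverage g 0 r =
        Real.circleAverage (fun w => (z - w)⁻¹) 0 r := fun hrR => by
      refine Real.circleAverage_congr_sphere fun w hw => ?_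
      rw [abs_of_pos hr0, mem_sphere_zero_iff_norm] at hw
      have : w ∈ Metric.ball (0 : ℂ) R := by simpa [hw] using hrR
      simp [hg, this]
    rcases lt_or_gt_of_ne hrz with h1 | h1
    · rw [hgr (h1.trans h), circleAverage_inv_sub_of_lt hr0 h1,
        Set.indicator_of_mem (show r ∈ Set.Ioc 0 ‖z‖ from ⟨hr0, h1.le⟩), Complex.real_smul]
      ring
    · rw [Set.indicator_of_notMem (fun h2 => not_lt.2 h2.2 h1)]
      have : Real.circleAverage g 0 r = 0 := by
        by_cases hrR : r < R
        · rw [hgr hrR, circleAverage_inv_sub_of_gt h1]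
        · refine (Real.circleAverage_congr_sphere (f₂ := fun _ => (0 : ℂ)) fun w hw => ?_).trans
            (Real.circleAverage_const 0 0 r)
          rw [abs_of_pos hr0, mem_sphere_zero_iff_norm] at hw
          have : w ∉ Metric.ball (0 : ℂ) R := by simpa [hw] using hrR
          simp [hg, this]
      simp [this]
  rw [integral_congr_ae inner, setIntegral_indicator measurableSet_Ioc,
    Set.inter_eq_self_of_subset_right (fun x hx => hx.1),
    ← intervalIntegral.integral_of_le (norm_nonneg z), intervalIntegral.integral_const_mul,
    intervalIntegral.integral_ofReal, integral_id]
  rcases eq_or_ne z 0 with rfl | hz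
  · simp
  have : ((‖z‖ ^ 2 : ℝ) : ℂ) = z * starRingEnd ℂ z := by
    rw [Complex.mul_conj, Complex.normSq_eq_norm_sq]
  push_cast at this ⊢
  rw [this]
  field_simp
  ring

/-- `u` is real differentiable at `z` with differential `a dz + b dz̄`. -/
def HasWirtingerAt (u : ℂ → ℂ) (a b z : ℂ) : Prop :=
  HasFDerivAt u (a • ContinuousLinearMap.id ℝ ℂ + b • (Complex.conjCLE : ℂ →L[ℝ] ℂ)) z

/-- Hölder continuity on a set, with some exponent at most `1/2`. -/
def HolOn (K : Set ℂ) (f : ℂ → ℂ) : Prop :=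
  ∃ C α : ℝ, 0 ≤ C ∧ 0 < α ∧ α ≤ 1 / 2 ∧ ∀ x ∈ K, ∀ y ∈ K, ‖f x - f y‖ ≤ C * ‖x - y‖ ^ α

/-- Hölder continuity on every disk. -/
def LocHol (f : ℂ → ℂ) : Prop := ∀ r : ℝ, HolOn (Metric.closedBall 0 r) f

theorem wirtinger_apply (a b t : ℂ) :
    (a • ContinuousLinearMap.id ℝ ℂ + b • (Complex.conjCLE : ℂ →L[ℝ] ℂ)) t =
      a * t + b * starRingEnd ℂ t := by
  simp

theorem hasWirtingerAt_of_norm_le {u : ℂ → ℂ} {a b z : ℂ} {C α r : ℝ} (hα : 0 < α) (hr : 0 < r)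
    (h : ∀ x ∈ Metric.ball z r,
      ‖u x - u z - a * (x - z) - b * starRingEnd ℂ (x - z)‖ ≤ C * ‖x - z‖ ^ (1 + α)) :
    HasWirtingerAt u a b z := by
  rw [HasWirtingerAt, hasFDerivAt_iff_isLittleO, Asymptotics.isLittleO_iff]
  intro c hc
  have ht : Filter.Tendsto (fun x : ℂ => C * ‖x - z‖ ^ α) (nhds z) (nhds 0) := by
    have : Continuous fun x : ℂ => C * ‖x - z‖ ^ α := by
      refine continuous_const.mul (Continuous.rpow_const (by fun_prop) fun _ => Or.inr hα.le)
    simpa [Real.zero_rpow hα.ne'] using this.tendsto z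
  filter_upwards [Metric.ball_mem_nhds z hr, ht.eventually (gt_mem_nhds hc)] with x hx hxc
  rw [wirtinger_apply, ← sub_sub]
  refine (h x hx).trans ?_
  rcases eq_or_ne x z with rfl | hxz
  · simp [Real.zero_rpow (by linarith : 1 + α ≠ 0)]
  have hp : 0 < ‖x - z‖ := norm_pos_iff.2 (sub_ne_zero.2 hxz)
  rw [Real.rpow_add hp, Real.rpow_one]
  nlinarith

section regularity

variable {f : ℂ → ℂ} {R A H α : ℝ}

theorem norm_div_sq_le (h1 : α < 1) (h0 : 0 < α)
    (hH : ∀ x y, ‖f x - f y‖ ≤ H * ‖x - y‖ ^ α) (z w : ℂ) :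
    ‖((z - w) ^ 2)⁻¹ * (f w - f z)‖ ≤ H * ‖z - w‖ ^ (α - 2) := by
  rcases eq_or_ne z w with rfl | hzw
  · simp [Real.zero_rpow (by linarith : α - 2 ≠ 0)]
  have hp : 0 < ‖z - w‖ := norm_pos_iff.2 (sub_ne_zero.2 hzw)
  have h2 : ‖z - w‖ ^ (α - 2) = (‖z - w‖ ^ 2)⁻¹ * ‖z - w‖ ^ α := by
    rw [Real.rpow_sub hp, Real.rpow_ofNat, div_eq_inv_mul]
  rw [h2, norm_mul, norm_inv, norm_pow]
  have := hH w z
  rw [norm_sub_rev w z] at this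
  calc (‖z - w‖ ^ 2)⁻¹ * ‖f w - f z‖ ≤ (‖z - w‖ ^ 2)⁻¹ * (H * ‖z - w‖ ^ α) := by gcongr
    _ = _ := by ring

theorem integrableOn_div_sq (hf : Continuous f) (h0 : 0 < α) (h1 : α < 1) (hH0 : 0 ≤ H)
    (hH : ∀ x y, ‖f x - f y‖ ≤ H * ‖x - y‖ ^ α) (z : ℂ) (r : ℝ) :
    IntegrableOn (fun w => ((z - w) ^ 2)⁻¹ * (f w - f z)) (Metric.ball 0 r) := by
  have hm := hf.measurable
  have hc : IntegrableOn (fun _ : ℂ => (1 : ℝ)) (Metric.ball 0 r) :=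
    integrableOn_const measure_ball_lt_top.ne
  refine Integrable.mono'
    (((integrable_radialMajorant_sub h0 h1 z).integrableOn.add hc).const_mul H)
    (by fun_prop : Measurable fun w => ((z - w) ^ 2)⁻¹ * (f w - f z)).aestronglyMeasurable
    (Filter.Eventually.of_forall fun w => (norm_div_sq_le h1 h0 hH z w).trans ?_)
  refine mul_le_mul_of_nonneg_left ?_ hH0
  simp only [Pi.add_apply, radialMajorant]
  split_ifs with h
  · linarith
  · have : ‖z - w‖ ^ (α - 2) ≤ 1 :=
      Real.rpow_le_one_of_one_le_of_nonpos (not_le.1 h).le (by linarith)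
    have : 0 ≤ ‖z - w‖ ^ (α - 3) := by positivity
    linarith

theorem cauchyTransform_eq_setIntegral (hf : BddSupp R A f) {r : ℝ} (hr : R < r) {z : ℂ}
    (hz : ‖z‖ < r) (c : ℂ) :
    cauchyTransform f z = (2 * Real.pi : ℂ)⁻¹ *
      (∫ w in Metric.ball (0 : ℂ) r, (z - w)⁻¹ * (f w - c)) + c / 2 * starRingEnd ℂ z := by
  have h1 : ∫ w, (z - w)⁻¹ * f w = ∫ w in Metric.ball (0 : ℂ) r, (z - w)⁻¹ * f w := by
    refine (setIntegral_eq_integral_of_forall_compl_eq_zero fun w hw => ?_).symm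
    have : r ≤ ‖w‖ := by simpa using hw
    rw [hf.eq_zero w (hr.trans_le this), mul_zero]
  have hi : IntegrableOn (fun w => (z - w)⁻¹) (Metric.ball (0 : ℂ) r) :=
    (integrable_indicator_iff Metric.isOpen_ball.measurableSet).1
      (integrable_inv_sub_indicator z r)
  have h2 : ∫ w in Metric.ball (0 : ℂ) r, (z - w)⁻¹ * (f w - c) =
      (∫ w, (z - w)⁻¹ * f w) - Real.pi * starRingEnd ℂ z * c := by
    simp only [mul_sub]
    rw [integral_sub (hf.integrable_kernel_mul z).integrableOn (hi.mul_const c),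
      integral_mul_const, setIntegral_ball_inv_sub hz, h1]
  rw [h2, cauchyTransform]
  have := Real.pi_ne_zero
  field_simp
  ring

theorem cauchyTransform_taylor (hf : BddSupp R A f) (h0 : 0 < α) (h1 : α < 1) (hH0 : 0 ≤ H)
    (hH : ∀ x y, ‖f x - f y‖ ≤ H * ‖x - y‖ ^ α) :
    ∃ C : ℝ, 0 ≤ C ∧ ∀ r, R < r → ∀ z₀, ‖z₀‖ < r → ∃ v : ℂ, ∀ z, ‖z‖ < r →
      ‖cauchyTransform f z - cauchyTransform f z₀ - v * (z - z₀)
        - f z₀ / 2 * starRingEnd ℂ (z - z₀)‖ ≤ C * ‖z - z₀‖ ^ (1 + α) := by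
  obtain ⟨J, hJ, hJb⟩ := exists_integral_rpow_mul_inv_le h0 h1
  refine ⟨H * J, by positivity, fun r hr z₀ hz₀ => ⟨-((2 * Real.pi : ℂ)⁻¹ *
    ∫ w in Metric.ball (0 : ℂ) r, ((z₀ - w) ^ 2)⁻¹ * (f w - f z₀)), fun z hz => ?_⟩⟩
  rcases eq_or_ne z z₀ with rfl | hne
  · simp [Real.zero_rpow (by linarith : 1 + α ≠ 0)]
  set t : ℂ := z - z₀ with ht
  have ht0 : t ≠ 0 := sub_ne_zero.2 hne
  have htn : 0 < ‖t‖ := norm_pos_iff.2 ht0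
  have ker : ∀ z : ℂ, IntegrableOn (fun w => (z - w)⁻¹ * (f w - f z₀))
      (Metric.ball (0 : ℂ) r) := fun z => by
    simp only [mul_sub]
    exact (hf.integrable_kernel_mul z).integrableOn.sub
      (((integrable_indicator_iff Metric.isOpen_ball.measurableSet).1
        (integrable_inv_sub_indicator z r)).mul_const _)
  have hsq := integrableOn_div_sq hf.continuous h0 h1 hH0 hH z₀ r
  obtain ⟨hi, hv⟩ := hJb (-t) (neg_ne_zero.2 ht0)
  have hi' : Integrable (fun w : ℂ => ‖z₀ - w‖ ^ (α - 2) * ‖z₀ - w - -t‖⁻¹) :=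
    hi.comp_sub_left z₀
  have hv' : ∫ w : ℂ, ‖z₀ - w‖ ^ (α - 2) * ‖z₀ - w - -t‖⁻¹ ≤ J * ‖t‖ ^ (α - 1) := by
    rw [norm_neg] at hv
    rwa [integral_sub_left_eq_self
      (fun s : ℂ => ‖s‖ ^ (α - 2) * ‖s - -t‖⁻¹) volume z₀]
  have hae : ∀ᵐ w ∂(volume.restrict (Metric.ball (0 : ℂ) r)),
      ‖(z - w)⁻¹ * (f w - f z₀) - (z₀ - w)⁻¹ * (f w - f z₀)
        + t * (((z₀ - w) ^ 2)⁻¹ * (f w - f z₀))‖ ≤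
      H * ‖t‖ ^ 2 * (‖z₀ - w‖ ^ (α - 2) * ‖z₀ - w - -t‖⁻¹) := by
    refine ae_restrict_of_ae ?_
    filter_upwards [Measure.ae_ne volume z, Measure.ae_ne volume z₀] with w hw hw'
    have n1 : z - w ≠ 0 := sub_ne_zero.2 hw.symm
    have n2 : z₀ - w ≠ 0 := sub_ne_zero.2 hw'.symm
    have e : (z - w)⁻¹ * (f w - f z₀) - (z₀ - w)⁻¹ * (f w - f z₀)
        + t * (((z₀ - w) ^ 2)⁻¹ * (f w - f z₀)) =
        t ^ 2 * (z - w)⁻¹ * (((z₀ - w) ^ 2)⁻¹ * (f w - f z₀)) := by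
      rw [ht]
      field_simp
      ring
    have e' : z₀ - w - -t = z - w := by rw [ht]; ring
    rw [e, e', norm_mul, norm_mul, norm_pow, norm_inv]
    calc ‖t‖ ^ 2 * ‖z - w‖⁻¹ * ‖((z₀ - w) ^ 2)⁻¹ * (f w - f z₀)‖
        ≤ ‖t‖ ^ 2 * ‖z - w‖⁻¹ * (H * ‖z₀ - w‖ ^ (α - 2)) := by
          gcongr
          exact norm_div_sq_le h1 h0 hH z₀ w
      _ = _ := by ring
  have e : cauchyTransform f z - cauchyTransform f z₀ - -((2 * Real.pi : ℂ)⁻¹ *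
      ∫ w in Metric.ball (0 : ℂ) r, ((z₀ - w) ^ 2)⁻¹ * (f w - f z₀)) * t
        - f z₀ / 2 * starRingEnd ℂ t = (2 * Real.pi : ℂ)⁻¹ *
      ∫ w in Metric.ball (0 : ℂ) r, ((z - w)⁻¹ * (f w - f z₀) - (z₀ - w)⁻¹ * (f w - f z₀)
        + t * (((z₀ - w) ^ 2)⁻¹ * (f w - f z₀))) := by
    have i1 := integral_add ((ker z).sub (ker z₀)) (hsq.const_mul t)
    simp only [Pi.sub_apply] at i1
    rw [i1, integral_sub (ker z) (ker z₀), integral_const_mul,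
      cauchyTransform_eq_setIntegral hf hr hz (f z₀),
      cauchyTransform_eq_setIntegral hf hr hz₀ (f z₀), ht, map_sub]
    ring
  rw [e, norm_mul]
  calc _ ≤ 1 * ∫ w in Metric.ball (0 : ℂ) r,
        H * ‖t‖ ^ 2 * (‖z₀ - w‖ ^ (α - 2) * ‖z₀ - w - -t‖⁻¹) := by
        gcongr
        · exact norm_two_pi_inv_le
        · exact norm_integral_le_of_norm_le (hi'.integrableOn.const_mul _) hae
    _ ≤ H * ‖t‖ ^ 2 * (J * ‖t‖ ^ (α - 1)) := by
        rw [one_mul, integral_const_mul]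
        gcongr
        refine (setIntegral_le_integral hi' (Filter.Eventually.of_forall fun w => ?_)).trans hv'
        simp only [Pi.zero_apply]
        positivity
    _ = H * J * ‖t‖ ^ (1 + α) := by
        rw [show 1 + α = (α - 1) + 2 by ring, Real.rpow_add htn, Real.rpow_ofNat]
        ring

end regularity

theorem exists_wirtinger_cauchyTransform {f : ℂ → ℂ} {R A : ℝ} (hf : BddSupp R A f)
    (hh : HolOn Set.univ f) :
    ∃ v : ℂ → ℂ, LocHol v ∧ ∀ z, HasWirtingerAt (cauchyTransform f) (v z) (f z / 2) z := by
  obtain ⟨H, α, hH0, h0, hα, hH⟩ := hh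
  have hH' : ∀ x y, ‖f x - f y‖ ≤ H * ‖x - y‖ ^ α := fun x y => hH x trivial y trivial
  obtain ⟨C, hC, hT⟩ := cauchyTransform_taylor hf h0 (by linarith) hH0 hH'
  have hW : ∀ r, R < r → ∀ z₀, ‖z₀‖ < r → ∀ v : ℂ, (∀ z, ‖z‖ < r →
      ‖cauchyTransform f z - cauchyTransform f z₀ - v * (z - z₀)
        - f z₀ / 2 * starRingEnd ℂ (z - z₀)‖ ≤ C * ‖z - z₀‖ ^ (1 + α)) →
      HasWirtingerAt (cauchyTransform f) v (f z₀ / 2) z₀ := by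
    intro r hr z₀ hz₀ v hv
    refine hasWirtingerAt_of_norm_le (C := C) h0 (sub_pos.2 hz₀) fun x hx => hv x ?_
    have := norm_add_le z₀ (x - z₀)
    rw [Metric.mem_ball, dist_eq_norm] at hx
    rw [add_sub_cancel] at this
    linarith
  set v : ℂ → ℂ := fun z => fderiv ℝ (cauchyTransform f) z 1 - f z / 2 with hv
  have hT' : ∀ r, R < r → ∀ z₀, ‖z₀‖ < r → ∀ z, ‖z‖ < r →
      ‖cauchyTransform f z - cauchyTransform f z₀ - v z₀ * (z - z₀)
        - f z₀ / 2 * starRingEnd ℂ (z - z₀)‖ ≤ C * ‖z - z₀‖ ^ (1 + α) := by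
    intro r hr z₀ hz₀
    obtain ⟨v', hv'⟩ := hT r hr z₀ hz₀
    have : v z₀ = v' := by
      have h := HasFDerivAt.fderiv (hW r hr z₀ hz₀ v' hv')
      simp only [hv, h, wirtinger_apply]
      simp
    rw [this]
    exact hv'
  refine ⟨v, fun r => ?_, fun z => ?_⟩
  · refine ⟨C * (2 ^ (1 + α) + 2) + H, α, by positivity, h0, hα, fun x hx y hy => ?_⟩
    rw [mem_closedBall_zero_iff] at hx hy
    rcases eq_or_ne x y with rfl | hxy
    · simp [Real.zero_rpow h0.ne']
    set s : ℂ := x - y with hs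
    have hsn : 0 < ‖s‖ := norm_pos_iff.2 (sub_ne_zero.2 hxy)
    set ρ : ℝ := max (R + 1) (4 * r + 1) with hρ
    have hρ1 : R < ρ := (lt_add_one R).trans_le (le_max_left _ _)
    have hρ2 : 4 * r + 1 ≤ ρ := le_max_right _ _
    have hr0 : 0 ≤ r := (norm_nonneg x).trans hx
    have hxs : ‖x + s‖ < ρ := by
      have := norm_add_le x s
      have := norm_sub_le x y
      rw [← hs] at this
      linarith
    have b1 := hT' ρ hρ1 y (by linarith) (x + s) hxs
    have b2 := hT' ρ hρ1 y (by linarith) x (by linarith)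
    have b3 := hT' ρ hρ1 x (by linarith) (x + s) hxs
    rw [show x + s - y = 2 * s by rw [hs]; ring] at b1
    rw [add_sub_cancel_left] at b3
    rw [← hs] at b2
    have hsum : (v x - v y) * s = (cauchyTransform f (x + s) - cauchyTransform f y
          - v y * (2 * s) - f y / 2 * starRingEnd ℂ (2 * s))
        - (cauchyTransform f x - cauchyTransform f y - v y * s - f y / 2 * starRingEnd ℂ s)
        - (cauchyTransform f (x + s) - cauchyTransform f x - v x * s
          - f x / 2 * starRingEnd ℂ s) - (f x - f y) / 2 * starRingEnd ℂ s := by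
      simp only [map_mul, map_ofNat]
      ring
    have e1 : ‖2 * s‖ ^ (1 + α) = 2 ^ (1 + α) * ‖s‖ ^ (1 + α) := by
      rw [norm_mul, Complex.norm_ofNat, Real.mul_rpow (by norm_num) (norm_nonneg s)]
    have e2 : ‖s‖ ^ (1 + α) = ‖s‖ ^ α * ‖s‖ := by
      rw [add_comm, Real.rpow_add hsn, Real.rpow_one]
    have b4 : ‖(f x - f y) / 2 * starRingEnd ℂ s‖ ≤ H * ‖s‖ ^ α * ‖s‖ := by
      rw [norm_mul, norm_div, RCLike.norm_conj, Complex.norm_ofNat]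
      have := hH' x y
      rw [← hs] at this
      gcongr
      linarith [norm_nonneg (f x - f y)]
    have tot : ‖v x - v y‖ * ‖s‖ ≤ ((C * (2 ^ (1 + α) + 2) + H) * ‖s‖ ^ α) * ‖s‖ := by
      rw [← norm_mul, hsum]
      refine (norm_sub_le _ _).trans ?_
      refine (add_le_add_left (norm_sub_le _ _) _).trans ?_
      refine (add_le_add_left (add_le_add_left (norm_sub_le _ _) _) _).trans ?_
      rw [e1, e2] at b1
      rw [e2] at b2 b3
      linarith
    exact le_of_mul_le_mul_right tot hsn
  · have hr : R < max (R + 1) (‖z‖ + 1) := (lt_add_one R).trans_le (le_max_left _ _)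
    have hz : ‖z‖ < max (R + 1) (‖z‖ + 1) := (lt_add_one _).trans_le (le_max_right _ _)
    exact hW _ hr z hz (v z) (hT' _ hr z hz)

section holder

variable {K : Set ℂ} {f g : ℂ → ℂ}

theorem rpow_le_rpow_sub_mul_rpow {t D α γ : ℝ} (ht : 0 ≤ t) (htD : t ≤ D) (hγ : 0 < γ)
    (hα : γ ≤ α) : t ^ α ≤ D ^ (α - γ) * t ^ γ := by
  rcases ht.eq_or_lt with rfl | hp
  · rw [Real.zero_rpow hγ.ne', Real.zero_rpow (by linarith), mul_zero]
  · calc t ^ α = t ^ (α - γ) * t ^ γ := by rw [← Real.rpow_add hp]; ring_nf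
      _ ≤ _ := by
        gcongr

theorem HolOn.of_two_bounds (hK : Bornology.IsBounded K) {C₁ C₂ α β : ℝ} (hC₁ : 0 ≤ C₁)
    (hC₂ : 0 ≤ C₂) (hα : 0 < α) (hβ : 0 < β)
    (h : ∀ x ∈ K, ∀ y ∈ K, ‖f x - f y‖ ≤ C₁ * ‖x - y‖ ^ α + C₂ * ‖x - y‖ ^ β) : HolOn K f := by
  obtain ⟨D, hD⟩ := Metric.isBounded_iff.1 hK
  have hγ : 0 < min (min α β) (1 / 2) := by positivity
  set γ := min (min α β) (1 / 2)
  have hγα : γ ≤ α := (min_le_left _ _).trans (min_le_left _ _)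
  have hγβ : γ ≤ β := (min_le_left _ _).trans (min_le_right _ _)
  refine ⟨C₁ * |D| ^ (α - γ) + C₂ * |D| ^ (β - γ), γ, by positivity, hγ, min_le_right _ _, ?_⟩
  intro x hx y hy
  have hxy : ‖x - y‖ ≤ |D| := by
    rw [← dist_eq_norm]
    exact (hD hx hy).trans (le_abs_self D)
  have h1 := rpow_le_rpow_sub_mul_rpow (norm_nonneg _) hxy hγ hγα
  have h2 := rpow_le_rpow_sub_mul_rpow (norm_nonneg _) hxy hγ hγβ
  calc ‖f x - f y‖ ≤ C₁ * ‖x - y‖ ^ α + C₂ * ‖x - y‖ ^ β := h x hx y hy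
    _ ≤ C₁ * (|D| ^ (α - γ) * ‖x - y‖ ^ γ) + C₂ * (|D| ^ (β - γ) * ‖x - y‖ ^ γ) := by gcongr
    _ = _ := by ring

theorem HolOn.exists_bound (hK : Bornology.IsBounded K) (hf : HolOn K f) :
    ∃ B, 0 ≤ B ∧ ∀ x ∈ K, ‖f x‖ ≤ B := by
  obtain ⟨D, hD⟩ := Metric.isBounded_iff.1 hK
  obtain ⟨C, α, hC, hα, -, h⟩ := hf
  rcases K.eq_empty_or_nonempty with rfl | ⟨x₀, hx₀⟩
  · exact ⟨0, le_rfl, by simp⟩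
  · refine ⟨‖f x₀‖ + C * |D| ^ α, by positivity, fun x hx => ?_⟩
    have hxy : ‖x - x₀‖ ≤ |D| := by
      rw [← dist_eq_norm]
      exact (hD hx hx₀).trans (le_abs_self D)
    calc ‖f x‖ ≤ ‖f x₀‖ + ‖f x - f x₀‖ := norm_le_insert' _ _
      _ ≤ ‖f x₀‖ + C * ‖x - x₀‖ ^ α := by gcongr; exact h x hx x₀ hx₀
      _ ≤ _ := by gcongr

theorem HolOn.add (hK : Bornology.IsBounded K) (hf : HolOn K f) (hg : HolOn K g) :
    HolOn K (fun x => f x + g x) := by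
  obtain ⟨C, α, hC, hα, -, h⟩ := hf
  obtain ⟨C', α', hC', hα', -, h'⟩ := hg
  refine HolOn.of_two_bounds hK hC hC' hα hα' fun x hx y hy => ?_
  calc ‖f x + g x - (f y + g y)‖ = ‖(f x - f y) + (g x - g y)‖ := by congr 1; ring
    _ ≤ ‖f x - f y‖ + ‖g x - g y‖ := norm_add_le _ _
    _ ≤ _ := add_le_add (h x hx y hy) (h' x hx y hy)

theorem HolOn.mul (hK : Bornology.IsBounded K) (hf : HolOn K f) (hg : HolOn K g) :
    HolOn K (fun x => f x * g x) := by
  obtain ⟨B, hB, hfB⟩ := hf.exists_bound hK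
  obtain ⟨B', hB', hgB⟩ := hg.exists_bound hK
  obtain ⟨C, α, hC, hα, -, h⟩ := hf
  obtain ⟨C', α', hC', hα', -, h'⟩ := hg
  refine HolOn.of_two_bounds hK (mul_nonneg hB' hC) (mul_nonneg hB hC') hα hα' fun x hx y hy => ?_
  calc ‖f x * g x - f y * g y‖ = ‖g x * (f x - f y) + f y * (g x - g y)‖ := by congr 1; ring
    _ ≤ ‖g x‖ * ‖f x - f y‖ + ‖f y‖ * ‖g x - g y‖ := by
      refine (norm_add_le _ _).trans ?_
      rw [norm_mul, norm_mul]
    _ ≤ B' * (C * ‖x - y‖ ^ α) + B * (C' * ‖x - y‖ ^ α') := by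
      gcongr
      · exact hgB x hx
      · exact h x hx y hy
      · exact hfB y hy
      · exact h' x hx y hy
    _ = _ := by ring

theorem HolOn.of_lipschitz (hK : Bornology.IsBounded K) {C : ℝ} (hC : 0 ≤ C)
    (h : ∀ x ∈ K, ∀ y ∈ K, ‖f x - f y‖ ≤ C * ‖x - y‖) : HolOn K f :=
  HolOn.of_two_bounds hK hC le_rfl one_pos one_pos fun x hx y hy => by simpa using h x hx y hy

theorem LocHol.add (hf : LocHol f) (hg : LocHol g) : LocHol (fun x => f x + g x) :=
  fun r => (hf r).add Metric.isBounded_closedBall (hg r)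

theorem LocHol.mul (hf : LocHol f) (hg : LocHol g) : LocHol (fun x => f x * g x) :=
  fun r => (hf r).mul Metric.isBounded_closedBall (hg r)

theorem LocHol.const (c : ℂ) : LocHol (fun _ => c) :=
  fun _ => HolOn.of_lipschitz Metric.isBounded_closedBall le_rfl fun x _ y _ => by simp

theorem LocHol.neg (hf : LocHol f) : LocHol (fun x => -f x) := by
  simpa using (LocHol.const (-1)).mul hf

theorem LocHol.sub (hf : LocHol f) (hg : LocHol g) : LocHol (fun x => f x - g x) := by
  simpa [sub_eq_add_neg] using hf.add hg.neg

theorem LocHol.div_const (hf : LocHol f) (c : ℂ) : LocHol (fun x => f x / c) := by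
  simpa [div_eq_mul_inv] using hf.mul (LocHol.const c⁻¹)

theorem LocHol.conj (hf : LocHol f) : LocHol (fun x => starRingEnd ℂ (f x)) := by
  intro r
  obtain ⟨C, α, hC, h0, h1, h⟩ := hf r
  refine ⟨C, α, hC, h0, h1, fun x hx y hy => ?_⟩
  rw [← map_sub, RCLike.norm_conj]
  exact h x hx y hy

theorem LocHol.continuous (hf : LocHol f) : Continuous f := by
  rw [continuous_iff_continuousAt]
  intro z
  obtain ⟨C, α, hC, h0, h1, h⟩ := hf (‖z‖ + 1)
  have hz : z ∈ Metric.closedBall (0 : ℂ) (‖z‖ + 1) := by simp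
  have ht : Filter.Tendsto (fun x : ℂ => C * ‖x - z‖ ^ α) (nhds z) (nhds 0) := by
    have : Continuous fun x : ℂ => C * ‖x - z‖ ^ α := by
      refine continuous_const.mul (Continuous.rpow_const (by fun_prop) fun _ => Or.inr h0.le)
    simpa [Real.zero_rpow h0.ne'] using this.tendsto z
  rw [ContinuousAt, tendsto_iff_norm_sub_tendsto_zero]
  refine squeeze_zero' (Filter.Eventually.of_forall fun _ => norm_nonneg _) ?_ ht
  filter_upwards [Metric.ball_mem_nhds z one_pos] with x hx
  refine h x ?_ z hz
  rw [mem_closedBall_zero_iff]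
  rw [mem_ball_iff_norm] at hx
  linarith [norm_le_insert' x z]

theorem LocHol.inv (hf : LocHol f) (h0 : ∀ z, f z ≠ 0) : LocHol (fun x => (f x)⁻¹) := by
  intro r
  obtain ⟨B, hB, hinv⟩ : ∃ B, 0 ≤ B ∧ ∀ x ∈ Metric.closedBall (0 : ℂ) r, ‖(f x)⁻¹‖ ≤ B := by
    obtain ⟨B, hB⟩ := (isCompact_closedBall (0 : ℂ) r).exists_bound_of_continuousOn
      (hf.continuous.inv₀ h0).continuousOn
    exact ⟨|B|, abs_nonneg _, fun x hx => (hB x hx).trans (le_abs_self B)⟩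
  obtain ⟨C, α, hC, hα, h1, h⟩ := hf r
  refine ⟨B * B * C, α, by positivity, hα, h1, fun x hx y hy => ?_⟩
  have : (f x)⁻¹ - (f y)⁻¹ = (f x)⁻¹ * (f y)⁻¹ * (f y - f x) := by
    field_simp [h0 x, h0 y]
  rw [this, norm_mul, norm_mul, norm_sub_rev, mul_assoc _ C]
  gcongr
  · exact hinv x hx
  · exact hinv y hy
  · exact h x hx y hy

/-- Locally Hölder continuous functions vanishing outside some disk. -/
structure HolSupp (f : ℂ → ℂ) : Prop where
  locHol : LocHol f
  eq_zero : ∃ R : ℝ, ∀ x, R < ‖x‖ → f x = 0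

theorem HolSupp.mul (hf : HolSupp f) (hg : LocHol g) : HolSupp (fun x => f x * g x) := by
  obtain ⟨R, hR⟩ := hf.eq_zero
  exact ⟨hf.locHol.mul hg, R, fun x hx => by rw [hR x hx, zero_mul]⟩

theorem HolSupp.conj (hf : HolSupp f) : HolSupp (fun x => starRingEnd ℂ (f x)) := by
  obtain ⟨R, hR⟩ := hf.eq_zero
  exact ⟨hf.locHol.conj, R, fun x hx => by rw [hR x hx, map_zero]⟩

theorem HolSupp.bddSupp (hf : HolSupp f) : ∃ R A, BddSupp R A f := by
  obtain ⟨R, hR⟩ := hf.eq_zero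
  obtain ⟨B, hB, hfB⟩ := (hf.locHol R).exists_bound Metric.isBounded_closedBall
  refine ⟨R, B, hf.locHol.continuous, fun x => ?_, hR⟩
  rcases le_or_gt ‖x‖ R with hx | hx
  · exact hfB x (by simpa using hx)
  · rwa [hR x hx, norm_zero]

theorem HolSupp.holOn_univ (hf : HolSupp f) : HolOn Set.univ f := by
  obtain ⟨R, A, hb⟩ := hf.bddSupp
  obtain ⟨C, α, hC, h0, h1, h⟩ := hf.locHol (R + 1)
  have hA := hb.nonneg
  refine ⟨C + A, α, by positivity, h0, h1, ?_⟩
  have key : ∀ x y, ‖x‖ ≤ ‖y‖ → ‖f x - f y‖ ≤ (C + A) * ‖x - y‖ ^ α := by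
    intro x y hxy
    have hp : 0 ≤ ‖x - y‖ ^ α := by positivity
    rcases le_or_gt ‖y‖ (R + 1) with hy | hy
    · refine (h x (by simpa using hxy.trans hy) y (by simpa using hy)).trans ?_
      nlinarith
    · rw [hb.eq_zero y (by linarith), sub_zero]
      rcases le_or_gt ‖x‖ R with hx | hx
      · have h3 : 1 ≤ ‖x - y‖ := by
          have := norm_sub_norm_le y x
          rw [norm_sub_rev] at this
          linarith
        have h4 : 1 ≤ ‖x - y‖ ^ α := Real.one_le_rpow h3 h0.le
        have := hb.norm_le x
        nlinarith
      · rw [hb.eq_zero x hx, norm_zero]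
        positivity
  intro x _ y _
  rcases le_total ‖x‖ ‖y‖ with hxy | hxy
  · exact key x y hxy
  · rw [norm_sub_rev, norm_sub_rev x]
    exact key y x hxy

end holder

section wirtinger

variable {u v : ℂ → ℂ} {a b a' b' z : ℂ}

theorem HasWirtingerAt.congr_coeff (h : HasWirtingerAt u a b z) (ha : a = a') (hb : b = b') :
    HasWirtingerAt u a' b' z := ha ▸ hb ▸ h

theorem HasWirtingerAt.of_fderiv {L : ℂ →L[ℝ] ℂ} (h : HasFDerivAt u L z)
    (hL : ∀ t, L t = a * t + b * starRingEnd ℂ t) : HasWirtingerAt u a b z := by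
  refine h.congr_fderiv ?_
  ext1 t
  rw [wirtinger_apply, hL]

theorem HasWirtingerAt.add (hu : HasWirtingerAt u a b z) (hv : HasWirtingerAt v a' b' z) :
    HasWirtingerAt (fun x => u x + v x) (a + a') (b + b') z := by
  refine .of_fderiv (HasFDerivAt.add hu hv) fun t => ?_
  rw [add_apply, wirtinger_apply, wirtinger_apply]
  ring

theorem HasWirtingerAt.mul (hu : HasWirtingerAt u a b z) (hv : HasWirtingerAt v a' b' z) :
    HasWirtingerAt (fun x => u x * v x) (a * v z + u z * a') (b * v z + u z * b') z := by
  refine .of_fderiv (HasFDerivAt.mul hu hv) fun t => ?_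
  rw [add_apply, smul_apply, smul_apply, wirtinger_apply, wirtinger_apply, smul_eq_mul,
    smul_eq_mul]
  ring

theorem HasWirtingerAt.const (c z : ℂ) : HasWirtingerAt (fun _ => c) 0 0 z :=
  .of_fderiv (hasFDerivAt_const c z) fun t => by simp

theorem HasWirtingerAt.neg (hu : HasWirtingerAt u a b z) :
    HasWirtingerAt (fun x => -u x) (-a) (-b) z := by
  have := (HasWirtingerAt.const (-1) z).mul hu
  simpa using this

theorem HasWirtingerAt.sub (hu : HasWirtingerAt u a b z) (hv : HasWirtingerAt v a' b' z) :
    HasWirtingerAt (fun x => u x - v x) (a - a') (b - b') z := by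
  simpa [sub_eq_add_neg] using hu.add hv.neg

theorem HasWirtingerAt.comp_deriv {φ : ℂ → ℂ} {c : ℂ} (hu : HasWirtingerAt u a b z)
    (hφ : HasDerivAt φ c (u z)) : HasWirtingerAt (fun x => φ (u x)) (c * a) (c * b) z := by
  refine .of_fderiv ((hφ.hasFDerivAt.restrictScalars ℝ).comp z hu) fun t => ?_
  simp only [ContinuousLinearMap.comp_apply, wirtinger_apply, ContinuousLinearMap.coe_restrictScalars']
  simp
  ring

theorem HasWirtingerAt.exp (hu : HasWirtingerAt u a b z) :
    HasWirtingerAt (fun x => Complex.exp (u x)) (Complex.exp (u z) * a) (Complex.exp (u z) * b) z :=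
  hu.comp_deriv (Complex.hasDerivAt_exp _)

theorem HasWirtingerAt.inv (hu : HasWirtingerAt u a b z) (h0 : u z ≠ 0) :
    HasWirtingerAt (fun x => (u x)⁻¹) (-(u z ^ 2)⁻¹ * a) (-(u z ^ 2)⁻¹ * b) z :=
  hu.comp_deriv (hasDerivAt_inv h0)

theorem HasWirtingerAt.conj (hu : HasWirtingerAt u a b z) :
    HasWirtingerAt (fun x => starRingEnd ℂ (u x)) (starRingEnd ℂ b) (starRingEnd ℂ a) z := by
  refine .of_fderiv ((Complex.conjCLE : ℂ →L[ℝ] ℂ).hasFDerivAt.comp z hu) fun t => ?_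
  simp only [ContinuousLinearMap.comp_apply, wirtinger_apply]
  simp
  ring

theorem HasWirtingerAt.const_mul_id (c z : ℂ) : HasWirtingerAt (fun x => c * x) c 0 z :=
  .of_fderiv ((hasFDerivAt_id (𝕜 := ℝ) z).const_mul c) fun t => by simp

end wirtinger

theorem LocHol.of_hasWirtingerAt {u a b : ℂ → ℂ} (h : ∀ z, HasWirtingerAt u (a z) (b z) z)
    (ha : Continuous a) (hb : Continuous b) : LocHol u := by
  intro r
  obtain ⟨A, hA⟩ := (isCompact_closedBall (0 : ℂ) r).exists_bound_of_continuousOn ha.continuousOn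
  obtain ⟨B, hB⟩ := (isCompact_closedBall (0 : ℂ) r).exists_bound_of_continuousOn hb.continuousOn
  refine HolOn.of_lipschitz Metric.isBounded_closedBall (C := |A| + |B|) (by positivity)
    fun x hx y hy => ?_
  refine (convex_closedBall (0 : ℂ) r).norm_image_sub_le_of_norm_hasFDerivWithin_le
    (fun z _ => (h z).hasFDerivWithinAt) (fun z hz => ?_) hy hx
  refine ContinuousLinearMap.opNorm_le_bound _ (by positivity) fun t => ?_
  rw [wirtinger_apply]
  refine (norm_add_le _ _).trans ?_
  rw [norm_mul, norm_mul, RCLike.norm_conj, ← add_mul]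
  gcongr
  · exact (hA z hz).trans (le_abs_self A)
  · exact (hB z hz).trans (le_abs_self B)

/-- `u` is real differentiable everywhere, with locally Hölder continuous Wirtinger coefficients
`a` and `b`. -/
structure C1H (u a b : ℂ → ℂ) : Prop where
  deriv : ∀ z, HasWirtingerAt u (a z) (b z) z
  left : LocHol a
  right : LocHol b

namespace C1H

variable {u v a b a' b' : ℂ → ℂ}

theorem locHol (h : C1H u a b) : LocHol u :=
  .of_hasWirtingerAt h.deriv h.left.continuous h.right.continuous

theorem add (hu : C1H u a b) (hv : C1H v a' b') :
    C1H (fun x => u x + v x) (fun x => a x + a' x) (fun x => b x + b' x) :=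
  ⟨fun z => (hu.deriv z).add (hv.deriv z), hu.left.add hv.left, hu.right.add hv.right⟩

theorem mul (hu : C1H u a b) (hv : C1H v a' b') :
    C1H (fun x => u x * v x) (fun x => a x * v x + u x * a' x)
      (fun x => b x * v x + u x * b' x) :=
  ⟨fun z => (hu.deriv z).mul (hv.deriv z),
    (hu.left.mul hv.locHol).add (hu.locHol.mul hv.left),
    (hu.right.mul hv.locHol).add (hu.locHol.mul hv.right)⟩

theorem const (c : ℂ) : C1H (fun _ => c) (fun _ => 0) (fun _ => 0) :=
  ⟨fun z => .const c z, .const 0, .const 0⟩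

theorem neg (hu : C1H u a b) : C1H (fun x => -u x) (fun x => -a x) (fun x => -b x) :=
  ⟨fun z => (hu.deriv z).neg, hu.left.neg, hu.right.neg⟩

theorem conj (hu : C1H u a b) :
    C1H (fun x => starRingEnd ℂ (u x)) (fun x => starRingEnd ℂ (b x))
      (fun x => starRingEnd ℂ (a x)) :=
  ⟨fun z => (hu.deriv z).conj, hu.right.conj, hu.left.conj⟩

theorem const_mul_id (c : ℂ) : C1H (fun x => c * x) (fun _ => c) (fun _ => 0) :=
  ⟨fun z => .const_mul_id c z, .const c, .const 0⟩

theorem exp (hu : C1H u a b) :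
    C1H (fun x => Complex.exp (u x)) (fun x => Complex.exp (u x) * a x)
      (fun x => Complex.exp (u x) * b x) := by
  have hd : ∀ z, HasWirtingerAt (fun x => Complex.exp (u x)) (Complex.exp (u z) * a z)
      (Complex.exp (u z) * b z) z := fun z => (hu.deriv z).exp
  have hc := hu.locHol.continuous.cexp
  have hl : LocHol (fun x => Complex.exp (u x)) :=
    .of_hasWirtingerAt hd (hc.mul hu.left.continuous) (hc.mul hu.right.continuous)
  exact ⟨hd, hl.mul hu.left, hl.mul hu.right⟩

theorem congr_coeff (hu : C1H u a b) (ha : ∀ z, a z = a' z) (hb : ∀ z, b z = b' z) :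
    C1H u a' b' := by
  rwa [← funext ha, ← funext hb]

end C1H

/-- The transform conjugate to the Cauchy transform, inverting `∂`. -/
noncomputable def conjCauchyTransform (f : ℂ → ℂ) (z : ℂ) : ℂ :=
  starRingEnd ℂ (cauchyTransform (fun w => starRingEnd ℂ (f w)) z)

theorem HolSupp.exists_c1h_cauchyTransform {f : ℂ → ℂ} (hf : HolSupp f) :
    ∃ a, C1H (cauchyTransform f) a (fun z => f z / 2) := by
  obtain ⟨R, A, hb⟩ := hf.bddSupp
  obtain ⟨v, hv, h⟩ := exists_wirtinger_cauchyTransform hb hf.holOn_univ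
  exact ⟨v, h, hv, hf.locHol.div_const 2⟩

theorem HolSupp.exists_c1h_conjCauchyTransform {f : ℂ → ℂ} (hf : HolSupp f) :
    ∃ b, C1H (conjCauchyTransform f) (fun z => f z / 2) b := by
  obtain ⟨a, ha⟩ := hf.conj.exists_c1h_cauchyTransform
  exact ⟨_, ha.conj.congr_coeff (fun z => by simp [Complex.conj_ofNat]) fun z => rfl⟩

/-- The unimodular exponential `exp (ζ z - conj (ζ z))`. -/
noncomputable def osc (ζ z : ℂ) : ℂ := Complex.exp (ζ * z - starRingEnd ℂ (ζ * z))

theorem norm_osc (ζ z : ℂ) : ‖osc ζ z‖ = 1 := by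
  rw [osc, Complex.norm_exp]
  simp

theorem conj_osc (ζ z : ℂ) : starRingEnd ℂ (osc ζ z) = osc (-ζ) z := by
  rw [osc, osc, ← Complex.exp_conj]
  congr 1
  simp
  ring

theorem locHol_osc (ζ : ℂ) : LocHol (osc ζ) := by
  have h := C1H.const_mul_id ζ
  have h' : osc ζ = fun x => Complex.exp (ζ * x + -starRingEnd ℂ (ζ * x)) := by
    funext x
    rw [osc, sub_eq_add_neg]
  rw [h']
  exact (h.add h.conj.neg).exp.locHol

theorem continuous_osc (ζ : ℂ) : Continuous (osc ζ) := (locHol_osc ζ).continuous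

theorem osc_add_half_period {ζ : ℂ} (hζ : ζ ≠ 0) (w : ℂ) :
    osc ζ (w + Complex.I * Real.pi / (2 * ζ)) = -osc ζ w := by
  have h : ζ * (Complex.I * Real.pi / (2 * ζ)) = Complex.I * Real.pi / 2 := by
    field_simp
  have hc : starRingEnd ℂ (Complex.I * Real.pi / 2) = -(Complex.I * Real.pi / 2) := by
    rw [map_div₀, map_mul, Complex.conj_I, Complex.conj_ofReal, Complex.conj_ofNat]
    ring
  rw [osc, osc, mul_add, h, map_add, hc]
  have : ζ * w + Complex.I * Real.pi / 2 - (starRingEnd ℂ (ζ * w) + -(Complex.I * Real.pi / 2)) =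
      (ζ * w - starRingEnd ℂ (ζ * w)) + Real.pi * Complex.I := by ring
  rw [this, Complex.exp_add, Complex.exp_pi_mul_I]
  ring

theorem cauchyTransform_comp_add (f : ℂ → ℂ) (τ z : ℂ) :
    cauchyTransform (fun w => f (w + τ)) z = cauchyTransform f (z + τ) := by
  rw [cauchyTransform, cauchyTransform,
    ← integral_add_right_eq_self (fun w => (z + τ - w)⁻¹ * f w) τ]
  simp only [add_sub_add_right_eq_sub]

theorem two_mul_cauchyTransform_osc {R A : ℝ} {g : ℂ → ℂ} (hg : BddSupp R A g) {ζ : ℂ}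
    (hζ : ζ ≠ 0) (z : ℂ) {τ : ℂ} (hτ : τ = Complex.I * Real.pi / (2 * ζ)) :
    2 * cauchyTransform (fun w => osc ζ w * g w) z =
      (cauchyTransform (fun w => osc ζ w * g w) z -
        cauchyTransform (fun w => osc ζ w * g w) (z + τ)) +
      cauchyTransform (fun w => osc ζ w * (g w - g (w + τ))) z := by
  have hg' : BddSupp (R + ‖τ‖) A (fun w => g (w + τ)) := by
    refine ⟨hg.continuous.comp (by fun_prop), fun x => hg.norm_le _, fun x hx => ?_⟩
    refine hg.eq_zero _ ?_
    have := norm_sub_le (x + τ) τ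
    rw [add_sub_cancel_right] at this
    linarith
  have h1 := cauchyTransform_sub (hg.unimodular_mul (continuous_osc ζ) (norm_osc ζ))
    (hg'.unimodular_mul (continuous_osc ζ) (norm_osc ζ)) z
  have h2 : cauchyTransform (fun w => osc ζ w * g w) (z + τ) =
      -cauchyTransform (fun w => osc ζ w * g (w + τ)) z := by
    rw [← cauchyTransform_comp_add]
    simp only [hτ, osc_add_half_period hζ]
    simp [cauchyTransform, integral_neg]
  have h3 : (fun w => osc ζ w * (g w - g (w + τ))) =
      fun w => osc ζ w * g w - osc ζ w * g (w + τ) := by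
    funext w
    ring
  rw [h2, h3, h1]
  ring

theorem exists_norm_cauchyTransform_osc_le (R : ℝ) :
    ∃ C, 0 ≤ C ∧ ∀ (A H β : ℝ) (g : ℂ → ℂ) (ζ : ℂ), BddSupp R A g → 0 ≤ H → 0 < β → β ≤ 1 / 2 →
      2 ≤ ‖ζ‖ → (∀ x y, ‖x - y‖ ≤ 1 → ‖g x - g y‖ ≤ H * ‖x - y‖ ^ β) →
      ∀ z, ‖cauchyTransform (fun w => osc ζ w * g w) z‖ ≤ C * (A + H) * (2 / ‖ζ‖) ^ β := by
  obtain ⟨C₁, hC₁, h₁⟩ := exists_norm_cauchyTransform_le (R + 1)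
  obtain ⟨C₂, hC₂, h₂⟩ := exists_norm_cauchyTransform_sub_le R
  refine ⟨C₁ + C₂, by positivity, fun A H β g ζ hg hH h0 hβ hζ hgH z => ?_⟩
  have hA := hg.nonneg
  have hζ0 : ζ ≠ 0 := by
    rintro rfl
    norm_num at hζ
  set τ := Complex.I * Real.pi / (2 * ζ) with hτ
  have hτn : ‖τ‖ ≤ 2 / ‖ζ‖ := by
    rw [hτ, norm_div, norm_mul, norm_mul, Complex.norm_I, Complex.norm_real, Real.norm_eq_abs,
      abs_of_pos Real.pi_pos, Complex.norm_ofNat, one_mul, div_le_div_iff₀ (by positivity)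
      (by positivity)]
    nlinarith [Real.pi_le_four]
  have hτ1 : ‖τ‖ ≤ 1 := hτn.trans ((div_le_one (by positivity)).2 hζ)
  have hp : 0 ≤ 2 / ‖ζ‖ := by positivity
  have hb1 : ‖τ‖ ^ (1 / 2 : ℝ) ≤ (2 / ‖ζ‖) ^ β := by
    calc ‖τ‖ ^ (1 / 2 : ℝ) ≤ (2 / ‖ζ‖) ^ (1 / 2 : ℝ) := by gcongr
      _ ≤ _ := Real.rpow_le_rpow_of_exponent_ge (by positivity)
        ((div_le_one (by positivity)).2 hζ) hβ
  have hb2 : ‖τ‖ ^ β ≤ (2 / ‖ζ‖) ^ β := by gcongr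
  have hd : ∀ w, ‖g w - g (w + τ)‖ ≤ H * (2 / ‖ζ‖) ^ β := fun w => by
    have h := hgH w (w + τ)
    rw [sub_add_cancel_left, norm_neg] at h
    exact (h hτ1).trans (by gcongr)
  have hs : BddSupp (R + 1) (H * (2 / ‖ζ‖) ^ β) (fun w => g w - g (w + τ)) := by
    refine ⟨hg.continuous.sub (hg.continuous.comp (by fun_prop)), hd, fun x hx => ?_⟩
    have := norm_sub_le (x + τ) τ
    rw [add_sub_cancel_right] at this
    rw [hg.eq_zero x (by linarith), hg.eq_zero (x + τ) (by linarith), sub_zero]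
  have e1 := h₁ _ _ (hs.unimodular_mul (continuous_osc ζ) (norm_osc ζ)) z
  have e2 := h₂ _ _ (hg.unimodular_mul (continuous_osc ζ) (norm_osc ζ)) z (z + τ)
  rw [sub_add_cancel_left, norm_neg] at e2
  have e3 := two_mul_cauchyTransform_osc hg hζ0 z hτ
  have e4 : 2 * ‖cauchyTransform (fun w => osc ζ w * g w) z‖ ≤
      C₂ * A * ‖τ‖ ^ (1 / 2 : ℝ) + C₁ * (H * (2 / ‖ζ‖) ^ β) := by
    calc 2 * ‖cauchyTransform (fun w => osc ζ w * g w) z‖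
        = ‖2 * cauchyTransform (fun w => osc ζ w * g w) z‖ := by
          rw [norm_mul, Complex.norm_ofNat]
      _ ≤ _ := by
          rw [e3]
          exact (norm_add_le _ _).trans (add_le_add e2 e1)
  set t := (2 / ‖ζ‖) ^ β
  have ht : 0 ≤ t := by positivity
  have e5 : C₂ * A * ‖τ‖ ^ (1 / 2 : ℝ) ≤ C₂ * A * t := by gcongr
  have e6 : 0 ≤ C₂ * A * t := by positivity
  have e7 : 0 ≤ C₁ * H * t := by positivity
  have e8 : 0 ≤ C₁ * A * t := by positivity
  have e9 : 0 ≤ C₂ * H * t := by positivity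
  nlinarith

namespace HolSupp

variable {f : ℂ → ℂ}

theorem bddSupp_mul {R A M : ℝ} (hf : BddSupp R A f) {m : ℂ → ℂ} (hm : Continuous m)
    (hM : ∀ x, ‖m x‖ ≤ M) : BddSupp R (A * M) (fun x => f x * m x) := by
  refine ⟨hf.continuous.mul hm, fun x => ?_, fun x hx => by rw [hf.eq_zero x hx, zero_mul]⟩
  rw [norm_mul]
  have := hf.nonneg
  gcongr
  · exact hf.norm_le x
  · exact hM x

theorem exists_uniform_bound (hf : HolSupp f) :
    ∃ K, 0 ≤ K ∧ ∀ (M : ℝ) (m : ℂ → ℂ) (ζ : ℂ), Continuous m → (∀ x, ‖m x‖ ≤ M) →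
      (∀ z, ‖cauchyTransform (fun w => osc ζ w * (f w * m w)) z‖ ≤ K * M) ∧
      ∀ z z', ‖cauchyTransform (fun w => osc ζ w * (f w * m w)) z -
        cauchyTransform (fun w => osc ζ w * (f w * m w)) z'‖ ≤ K * M * ‖z - z'‖ ^ (1 / 2 : ℝ) := by
  obtain ⟨R, A, hb⟩ := hf.bddSupp
  obtain ⟨C₁, hC₁, h₁⟩ := exists_norm_cauchyTransform_le R
  obtain ⟨C₂, hC₂, h₂⟩ := exists_norm_cauchyTransform_sub_le R
  have hA := hb.nonneg
  refine ⟨(C₁ + C₂) * A, by positivity, fun M m ζ hm hM => ?_⟩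
  have hM0 : 0 ≤ M := (norm_nonneg _).trans (hM 0)
  have hs := (bddSupp_mul hb hm hM).unimodular_mul (continuous_osc ζ) (norm_osc ζ)
  refine ⟨fun z => (h₁ _ _ hs z).trans ?_, fun z z' => (h₂ _ _ hs z z').trans ?_⟩
  · have : 0 ≤ C₂ * (A * M) := by positivity
    linarith
  · have : 0 ≤ C₁ * (A * M) := by positivity
    refine mul_le_mul_of_nonneg_right ?_ (by positivity)
    linarith

theorem exists_small (hf : HolSupp f) {ε : ℝ} (hε : 0 < ε) :
    ∃ N : ℝ, ∀ ζ : ℂ, N ≤ ‖ζ‖ → ∀ (M : ℝ) (m : ℂ → ℂ), Continuous m → (∀ x, ‖m x‖ ≤ M) →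
      (∀ x y, ‖m x - m y‖ ≤ M * ‖x - y‖ ^ (1 / 2 : ℝ)) →
      ∀ z, ‖cauchyTransform (fun w => osc ζ w * (f w * m w)) z‖ ≤ ε * M := by
  obtain ⟨R, A, hb⟩ := hf.bddSupp
  obtain ⟨H, α, hH, h0, h1, hfH⟩ := hf.holOn_univ
  obtain ⟨C, hC, h⟩ := exists_norm_cauchyTransform_osc_le R
  have hA := hb.nonneg
  have ht : Filter.Tendsto (fun r : ℝ => C * (A + (H + A)) * (2 / r) ^ α) Filter.atTop
      (nhds 0) := by
    have h2 : Filter.Tendsto (fun r : ℝ => 2 / r) Filter.atTop (nhds 0) :=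
      Filter.Tendsto.const_div_atTop Filter.tendsto_id 2
    have h3 := (h2.rpow_const (p := α) (Or.inr h0.le)).const_mul (C * (A + (H + A)))
    simpa [Real.zero_rpow h0.ne'] using h3
  obtain ⟨N, hN⟩ := Filter.eventually_atTop.1 (ht.eventually (gt_mem_nhds hε))
  refine ⟨max N 2, fun ζ hζ M m hm hM hmH z => ?_⟩
  have hM0 : 0 ≤ M := (norm_nonneg _).trans (hM 0)
  have hs := bddSupp_mul hb hm hM
  have := h (A * M) ((H + A) * M) α _ ζ hs (by positivity) h0 h1 ((le_max_right _ _).trans hζ)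
    (fun x y hxy => ?_) z
  · have hN' := (hN ‖ζ‖ ((le_max_left _ _).trans hζ)).le
    calc _ ≤ C * (A * M + (H + A) * M) * (2 / ‖ζ‖) ^ α := this
      _ = C * (A + (H + A)) * (2 / ‖ζ‖) ^ α * M := by ring
      _ ≤ _ := by gcongr
  · have e1 : ‖x - y‖ ^ (1 / 2 : ℝ) ≤ ‖x - y‖ ^ α := by
      rcases eq_or_ne x y with rfl | hne
      · simp [Real.zero_rpow h0.ne']
      · exact Real.rpow_le_rpow_of_exponent_ge (norm_pos_iff.2 (sub_ne_zero.2 hne)) hxy h1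
    calc ‖f x * m x - f y * m y‖ = ‖m x * (f x - f y) + f y * (m x - m y)‖ := by congr 1; ring
      _ ≤ ‖m x‖ * ‖f x - f y‖ + ‖f y‖ * ‖m x - m y‖ := by
        refine (norm_add_le _ _).trans ?_
        rw [norm_mul, norm_mul]
      _ ≤ M * (H * ‖x - y‖ ^ α) + A * (M * ‖x - y‖ ^ α) := by
        gcongr
        · exact hM x
        · exact hfH x trivial y trivial
        · exact hb.norm_le y
        · exact (hmH x y).trans (by gcongr)
      _ = _ := by ring

theorem conjCauchyTransform_osc (f m : ℂ → ℂ) (ζ z : ℂ) :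
    conjCauchyTransform (fun w => osc ζ w * (f w * m w)) z =
      starRingEnd ℂ (cauchyTransform
        (fun w => osc (-ζ) w * (starRingEnd ℂ (f w) * starRingEnd ℂ (m w))) z) := by
  simp only [conjCauchyTransform, map_mul, conj_osc]

theorem exists_conj_uniform_bound (hf : HolSupp f) :
    ∃ K, 0 ≤ K ∧ ∀ (M : ℝ) (m : ℂ → ℂ) (ζ : ℂ), Continuous m → (∀ x, ‖m x‖ ≤ M) →
      (∀ z, ‖conjCauchyTransform (fun w => osc ζ w * (f w * m w)) z‖ ≤ K * M) ∧
      ∀ z z', ‖conjCauchyTransform (fun w => osc ζ w * (f w * m w)) z -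
        conjCauchyTransform (fun w => osc ζ w * (f w * m w)) z'‖ ≤
          K * M * ‖z - z'‖ ^ (1 / 2 : ℝ) := by
  obtain ⟨K, hK, h⟩ := hf.conj.exists_uniform_bound
  refine ⟨K, hK, fun M m ζ hm hM => ?_⟩
  obtain ⟨h1, h2⟩ := h M (fun w => starRingEnd ℂ (m w)) (-ζ)
    (Complex.continuous_conj.comp hm) (fun x => by simpa using hM x)
  simp only [conjCauchyTransform_osc]
  refine ⟨fun z => ?_, fun z z' => ?_⟩
  · rw [RCLike.norm_conj]
    exact h1 z
  · rw [← map_sub, RCLike.norm_conj]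
    exact h2 z z'

theorem exists_conj_small (hf : HolSupp f) {ε : ℝ} (hε : 0 < ε) :
    ∃ N : ℝ, ∀ ζ : ℂ, N ≤ ‖ζ‖ → ∀ (M : ℝ) (m : ℂ → ℂ), Continuous m → (∀ x, ‖m x‖ ≤ M) →
      (∀ x y, ‖m x - m y‖ ≤ M * ‖x - y‖ ^ (1 / 2 : ℝ)) →
      ∀ z, ‖conjCauchyTransform (fun w => osc ζ w * (f w * m w)) z‖ ≤ ε * M := by
  obtain ⟨N, h⟩ := hf.conj.exists_small hε
  refine ⟨N, fun ζ hζ M m hm hM hmH z => ?_⟩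
  rw [conjCauchyTransform_osc, RCLike.norm_conj]
  refine h (-ζ) (by rwa [norm_neg]) M (fun w => starRingEnd ℂ (m w))
    (Complex.continuous_conj.comp hm) (fun x => by simpa using hM x) (fun x y => ?_) z
  rw [← map_sub, RCLike.norm_conj]
  exact hmH x y

end HolSupp

theorem LocHol.of_half_holder {f : ℂ → ℂ} {C : ℝ} (hC : 0 ≤ C)
    (h : ∀ x y, ‖f x - f y‖ ≤ C * ‖x - y‖ ^ (1 / 2 : ℝ)) : LocHol f :=
  fun _ => ⟨C, 1 / 2, hC, by norm_num, le_rfl, fun x _ y _ => h x y⟩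

theorem cauchyTransform_osc_sub {q m₁ m₂ : ℂ → ℂ} (hq : HolSupp q) (ζ : ℂ) {M₁ M₂ : ℝ}
    (hc₁ : Continuous m₁) (hc₂ : Continuous m₂) (h₁ : ∀ x, ‖m₁ x‖ ≤ M₁) (h₂ : ∀ x, ‖m₂ x‖ ≤ M₂)
    (z : ℂ) :
    cauchyTransform (fun w => osc ζ w * (q w * m₁ w)) z -
      cauchyTransform (fun w => osc ζ w * (q w * m₂ w)) z =
      cauchyTransform (fun w => osc ζ w * (q w * (m₁ w - m₂ w))) z := by
  obtain ⟨R, A, hb⟩ := hq.bddSupp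
  have := cauchyTransform_sub
    ((HolSupp.bddSupp_mul hb hc₁ h₁).unimodular_mul (continuous_osc ζ) (norm_osc ζ))
    ((HolSupp.bddSupp_mul hb hc₂ h₂).unimodular_mul (continuous_osc ζ) (norm_osc ζ)) z
  rw [← this]
  congr 1
  funext w
  ring

theorem conjCauchyTransform_osc_sub {p m₁ m₂ : ℂ → ℂ} (hp : HolSupp p) (ζ : ℂ) {M₁ M₂ : ℝ}
    (hc₁ : Continuous m₁) (hc₂ : Continuous m₂) (h₁ : ∀ x, ‖m₁ x‖ ≤ M₁) (h₂ : ∀ x, ‖m₂ x‖ ≤ M₂)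
    (z : ℂ) :
    conjCauchyTransform (fun w => osc ζ w * (p w * m₁ w)) z -
      conjCauchyTransform (fun w => osc ζ w * (p w * m₂ w)) z =
      conjCauchyTransform (fun w => osc ζ w * (p w * (m₁ w - m₂ w))) z := by
  simp only [HolSupp.conjCauchyTransform_osc, ← map_sub]
  rw [cauchyTransform_osc_sub hp.conj (-ζ) (m₁ := fun x => starRingEnd ℂ (m₁ x))
    (m₂ := fun x => starRingEnd ℂ (m₂ x)) (Complex.continuous_conj.comp hc₁)
    (Complex.continuous_conj.comp hc₂) (fun x => by simpa using h₁ x)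
    (fun x => by simpa using h₂ x)]
  simp

open BoundedContinuousFunction in
theorem exists_fixed_point_of_small {p q : ℂ → ℂ} (hp : HolSupp p) (hq : HolSupp q) (ζ : ℂ)
    (hsmall : ∀ (M : ℝ) (W : ℂ → ℂ), Continuous W → (∀ x, ‖W x‖ ≤ M) →
      ∀ z, ‖cauchyTransform (fun w => osc (-ζ) w *
        (q w * conjCauchyTransform (fun w => osc ζ w * (p w * W w)) w)) z‖ ≤ 1 / 5 * M) :
    ∃ W : ℂ → ℂ, Continuous W ∧ (∀ z, ‖W z‖ ≤ 5 / 4) ∧ ∀ z, W z = 1 +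
      cauchyTransform (fun w => osc (-ζ) w *
        (q w * conjCauchyTransform (fun w => osc ζ w * (p w * W w)) w)) z := by
  obtain ⟨Kp, hKp, hp'⟩ := hp.exists_conj_uniform_bound
  obtain ⟨Kq, hKq, hq'⟩ := hq.exists_uniform_bound
  set h : (ℂ → ℂ) → ℂ → ℂ := fun W => conjCauchyTransform (fun w => osc ζ w * (p w * W w)) with hh
  set T : (ℂ → ℂ) → ℂ → ℂ := fun W =>
    cauchyTransform (fun w => osc (-ζ) w * (q w * h W w)) with hT
  have hM : ∀ W : ℂ →ᵇ ℂ, ∀ x, ‖W x‖ ≤ ‖W‖ := fun W x => W.norm_coe_le_norm x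
  have hbd : ∀ W : ℂ →ᵇ ℂ, ∀ x, ‖h W x‖ ≤ Kp * ‖W‖ := fun W =>
    (hp' ‖W‖ W ζ W.continuous (hM W)).1
  have hcont : ∀ W : ℂ →ᵇ ℂ, Continuous (h W) := fun W =>
    (LocHol.of_half_holder (by positivity) (hp' ‖W‖ W ζ W.continuous (hM W)).2).continuous
  have hTcont : ∀ W : ℂ →ᵇ ℂ, Continuous (T W) := fun W =>
    (LocHol.of_half_holder (by positivity) (hq' _ _ (-ζ) (hcont W) (hbd W)).2).continuous
  have hTbd : ∀ W : ℂ →ᵇ ℂ, ∀ z, ‖T W z‖ ≤ 1 / 5 * ‖W‖ := fun W =>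
    hsmall ‖W‖ W W.continuous (hM W)
  let Φ : (ℂ →ᵇ ℂ) → (ℂ →ᵇ ℂ) := fun W =>
    BoundedContinuousFunction.ofNormedAddCommGroup (fun z => 1 + T W z)
      (continuous_const.add (hTcont W)) (1 + 1 / 5 * ‖W‖) (fun z => by
        refine (norm_add_le _ _).trans ?_
        rw [norm_one]
        gcongr
        exact hTbd W z)
  have hTsub : ∀ W₁ W₂ : ℂ →ᵇ ℂ, ∀ z, T W₁ z - T W₂ z = T (W₁ - W₂ : ℂ →ᵇ ℂ) z := by
    intro W₁ W₂ z
    simp only [hT]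
    rw [cauchyTransform_osc_sub hq (-ζ) (hcont W₁) (hcont W₂) (hbd W₁) (hbd W₂)]
    congr 1
    funext w
    simp only [hh]
    rw [conjCauchyTransform_osc_sub hp ζ W₁.continuous W₂.continuous (hM W₁) (hM W₂)]
    rfl
  have hΦ : ContractingWith (1 / 5 : NNReal) Φ := by
    refine ⟨by rw [← NNReal.coe_lt_coe]; norm_num, LipschitzWith.of_dist_le_mul fun W₁ W₂ => ?_⟩
    refine (BoundedContinuousFunction.dist_le (by positivity)).2 fun z => ?_
    change dist (1 + T W₁ z) (1 + T W₂ z) ≤ _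
    rw [dist_add_left, dist_eq_norm, dist_eq_norm, hTsub]
    simpa using hTbd (W₁ - W₂) z
  set W := hΦ.fixedPoint with hW
  have hfix : ∀ z, W z = 1 + T W z := fun z =>
    (DFunLike.congr_fun (hΦ.fixedPoint_isFixedPt : Φ W = W) z).symm
  have hn : ‖W‖ ≤ 1 + 1 / 5 * ‖W‖ := by
    refine (BoundedContinuousFunction.norm_le (by positivity)).2 fun z => ?_
    rw [hfix z]
    refine (norm_add_le _ _).trans ?_
    rw [norm_one]
    gcongr
    exact hTbd W z
  exact ⟨W, W.continuous, fun z => (hM W z).trans (by linarith), hfix⟩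

theorem exists_complex_geometric_optics {p q : ℂ → ℂ} (hp : HolSupp p) (hq : HolSupp q) :
    ∃ (ζ : ℂ) (h W a b : ℂ → ℂ), C1H h (fun z => osc ζ z * p z * W z / 2) b ∧
      C1H W a (fun z => osc (-ζ) z * q z * h z / 2) ∧ ∀ z, ‖h z‖ < ‖W z‖ := by
  obtain ⟨Kp, hKp, hp'⟩ := hp.exists_conj_uniform_bound
  obtain ⟨Kq, hKq, hq'⟩ := hq.exists_uniform_bound
  obtain ⟨N₁, hN₁⟩ := hq.exists_small (ε := 1 / (5 * (Kp + 1))) (by positivity)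
  obtain ⟨N₂, hN₂⟩ := hp.exists_conj_small (ε := 1 / (5 * (1 + Kq * Kp))) (by positivity)
  obtain ⟨ζ, hζ⟩ : ∃ ζ : ℂ, max N₁ N₂ ≤ ‖ζ‖ :=
    ⟨(|max N₁ N₂| : ℝ), by simpa using le_abs_self (max N₁ N₂)⟩
  have hsmall : ∀ (M : ℝ) (W : ℂ → ℂ), Continuous W → (∀ x, ‖W x‖ ≤ M) →
      ∀ z, ‖cauchyTransform (fun w => osc (-ζ) w *
        (q w * conjCauchyTransform (fun w => osc ζ w * (p w * W w)) w)) z‖ ≤ 1 / 5 * M := by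
    intro M W hc hM z
    have hM0 : 0 ≤ M := (norm_nonneg _).trans (hM 0)
    obtain ⟨h1, h2⟩ := hp' M W ζ hc hM
    refine (hN₁ (-ζ) (by rw [norm_neg]; exact (le_max_left _ _).trans hζ) (Kp * M) _
      (LocHol.of_half_holder (by positivity) h2).continuous h1 h2 z).trans ?_
    rw [div_mul_eq_mul_div, div_mul_eq_mul_div, div_le_div_iff₀ (by positivity) (by positivity)]
    nlinarith
  obtain ⟨W, hWc, hWn, hfix⟩ := exists_fixed_point_of_small hp hq ζ hsmall
  set h := conjCauchyTransform (fun w => osc ζ w * (p w * W w)) with hh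
  obtain ⟨h1, h2⟩ := hp' (5 / 4) W ζ hWc hWn
  have hhl : LocHol h := LocHol.of_half_holder (by positivity) h2
  obtain ⟨h3, h4⟩ := hq' _ h (-ζ) hhl.continuous h1
  have hWH : ∀ x y, ‖W x - W y‖ ≤ Kq * (Kp * (5 / 4)) * ‖x - y‖ ^ (1 / 2 : ℝ) := fun x y => by
    rw [hfix x, hfix y, add_sub_add_left_eq_sub]
    exact h4 x y
  have hWl : LocHol W := LocHol.of_half_holder (by positivity) hWH
  have hhn : ∀ z, ‖h z‖ ≤ 1 / 4 := fun z => by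
    refine (hN₂ ζ ((le_max_right _ _).trans hζ) (5 / 4 * (1 + Kq * Kp)) W hWc
      (fun x => (hWn x).trans ?_) (fun x y => (hWH x y).trans ?_) z).trans (le_of_eq ?_)
    · nlinarith [mul_nonneg hKq hKp]
    · refine mul_le_mul_of_nonneg_right ?_ (by positivity)
      linarith
    · have : 1 + Kq * Kp ≠ 0 := by positivity
      field_simp
  have hW1 : ∀ z, ‖W z - 1‖ ≤ 1 / 4 := fun z => by
    rw [hfix z, add_sub_cancel_left]
    exact (hsmall (5 / 4) W hWc hWn z).trans (by norm_num)
  have hs1 : HolSupp (fun w => osc ζ w * (p w * W w)) := by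
    simpa only [mul_comm] using (hp.mul hWl).mul (locHol_osc ζ)
  have hs2 : HolSupp (fun w => osc (-ζ) w * (q w * h w)) := by
    simpa only [mul_comm] using (hq.mul hhl).mul (locHol_osc (-ζ))
  obtain ⟨b, hb⟩ := hs1.exists_c1h_conjCauchyTransform
  obtain ⟨a, ha⟩ := hs2.exists_c1h_cauchyTransform
  have hWa := (C1H.const 1).add ha
  rw [← funext hfix] at hWa
  refine ⟨ζ, h, W, _, b, hb.congr_coeff (fun z => by ring) fun z => rfl,
    hWa.congr_coeff (fun z => rfl) fun z => by ring, fun z => ?_⟩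
  have := norm_sub_norm_le (1 : ℂ) (1 - W z)
  rw [sub_sub_cancel, norm_one, norm_sub_rev] at this
  linarith [hW1 z, hhn z]

theorem exists_dominated_solution {p q s t a d s' t' : ℂ → ℂ} (hp : HolSupp p) (hq : HolSupp q)
    (hs : C1H s (fun z => a z / 2) s') (ht : C1H t t' (fun z => d z / 2)) :
    ∃ u₁ u₂ b₁ a₂ : ℂ → ℂ, C1H u₁ (fun z => (a z * u₁ z + p z * u₂ z) / 2) b₁ ∧
      C1H u₂ a₂ (fun z => (q z * u₁ z + d z * u₂ z) / 2) ∧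
      ∀ z, ‖u₁ z‖ * ‖Complex.exp (t z)‖ < ‖u₂ z‖ * ‖Complex.exp (s z)‖ := by
  have hp' := hp.mul (ht.add hs.neg).exp.locHol
  have hq' := hq.mul (hs.add ht.neg).exp.locHol
  obtain ⟨ζ, h, W, a₂, b₁, hh, hW, hlt⟩ := exists_complex_geometric_optics hp' hq'
  have hζ := C1H.const_mul_id ζ
  have hE₁ := (hζ.conj.add hs).exp
  have hE₂ := (hζ.add ht).exp
  have e₁ : ∀ z, Complex.exp (starRingEnd ℂ (ζ * z) + s z) *
      (osc ζ z * Complex.exp (t z + -s z)) = Complex.exp (ζ * z + t z) := fun z => by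
    rw [osc, ← Complex.exp_add, ← Complex.exp_add]
    congr 1
    ring
  have e₂ : ∀ z, Complex.exp (ζ * z + t z) *
      (osc (-ζ) z * Complex.exp (s z + -t z)) = Complex.exp (starRingEnd ℂ (ζ * z) + s z) :=
    fun z => by
    rw [osc, ← Complex.exp_add, ← Complex.exp_add]
    congr 1
    rw [neg_mul, map_neg]
    ring
  refine ⟨fun z => Complex.exp (starRingEnd ℂ (ζ * z) + s z) * h z,
    fun z => Complex.exp (ζ * z + t z) * W z, _, _,
    (hE₁.mul hh).congr_coeff (fun z => ?_) (fun z => rfl),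
    (hE₂.mul hW).congr_coeff (fun z => rfl) (fun z => ?_), fun z => ?_⟩
  · rw [map_zero]
    linear_combination (p z * W z / 2) * e₁ z
  · linear_combination (q z * h z / 2) * e₂ z
  · have hn : ‖Complex.exp (starRingEnd ℂ (ζ * z))‖ = ‖Complex.exp (ζ * z)‖ := by
      rw [Complex.exp_conj, RCLike.norm_conj]
    simp only [norm_mul, Complex.exp_add, hn]
    have h1 : 0 < ‖Complex.exp (ζ * z)‖ := norm_pos_iff.2 (Complex.exp_ne_zero _)
    have h2 : 0 < ‖Complex.exp (s z)‖ := norm_pos_iff.2 (Complex.exp_ne_zero _)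
    have h3 : 0 < ‖Complex.exp (t z)‖ := norm_pos_iff.2 (Complex.exp_ne_zero _)
    calc ‖Complex.exp (ζ * z)‖ * ‖Complex.exp (s z)‖ * ‖h z‖ * ‖Complex.exp (t z)‖
        = ‖Complex.exp (ζ * z)‖ * ‖Complex.exp (s z)‖ * ‖Complex.exp (t z)‖ * ‖h z‖ := by ring
      _ < ‖Complex.exp (ζ * z)‖ * ‖Complex.exp (s z)‖ * ‖Complex.exp (t z)‖ * ‖W z‖ := by
        gcongr
        exact hlt z
      _ = _ := by ring

/-- The first-order system `∂u₁ = a u₁ + p u₂`, `∂̄u₂ = q u₁ + d u₂` with compactly supported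
Hölder continuous coefficients has two solutions which are linearly independent at every point. -/
theorem exists_fundamental_system {a p q d : ℂ → ℂ} (ha : HolSupp a) (hp : HolSupp p)
    (hq : HolSupp q) (hd : HolSupp d) :
    ∃ u₁ u₂ v₁ v₂ b₁ a₂ b₁' a₂' : ℂ → ℂ,
      C1H u₁ (fun z => (a z * u₁ z + p z * u₂ z) / 2) b₁ ∧
      C1H u₂ a₂ (fun z => (q z * u₁ z + d z * u₂ z) / 2) ∧
      C1H v₁ (fun z => (a z * v₁ z + p z * v₂ z) / 2) b₁' ∧
      C1H v₂ a₂' (fun z => (q z * v₁ z + d z * v₂ z) / 2) ∧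
      ∀ z, u₁ z * v₂ z - u₂ z * v₁ z ≠ 0 := by
  obtain ⟨s', hs⟩ := ha.exists_c1h_conjCauchyTransform
  obtain ⟨t', ht⟩ := hd.exists_c1h_cauchyTransform
  obtain ⟨u₁, u₂, b₁, a₂, hu₁, hu₂, hu⟩ := exists_dominated_solution hp hq hs ht
  have hs2 := hs.conj
  have ht2 := ht.conj
  simp only [map_div₀, Complex.conj_ofNat] at hs2 ht2
  obtain ⟨U₁, U₂, B₁, A₂, hU₁, hU₂, hU⟩ := exists_dominated_solution hq.conj hp.conj ht2 hs2
  refine ⟨u₁, u₂, fun z => starRingEnd ℂ (U₂ z), fun z => starRingEnd ℂ (U₁ z), _, _, _, _, hu₁,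
    hu₂, hU₂.conj.congr_coeff (fun z => ?_) (fun z => rfl),
    hU₁.conj.congr_coeff (fun z => rfl) (fun z => ?_), fun z hz => ?_⟩
  · simp only [map_div₀, map_add, map_mul, Complex.conj_conj, Complex.conj_ofNat]
    ring
  · simp only [map_div₀, map_add, map_mul, Complex.conj_conj, Complex.conj_ofNat]
    ring
  · have h1 := hu z
    have h2 := hU z
    rw [Complex.exp_conj, Complex.exp_conj, RCLike.norm_conj, RCLike.norm_conj] at h2
    have h3 : ‖u₁ z‖ * ‖U₁ z‖ = ‖u₂ z‖ * ‖U₂ z‖ := by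
      have := congrArg norm (sub_eq_zero.1 hz)
      simpa only [norm_mul, RCLike.norm_conj] using this
    have h4 := mul_lt_mul'' h1 h2 (by positivity) (by positivity)
    refine absurd h4 (not_lt.2 (le_of_eq ?_))
    linear_combination (-‖Complex.exp (conjCauchyTransform a z)‖ *
      ‖Complex.exp (cauchyTransform d z)‖) * h3

/-- A matrix of functions with columns `(u₁, u₂)` and `(v₁, v₂)`, together with the entries of
two connection matrices `p` and `q`. -/
structure Frame where
  (u₁ u₂ v₁ v₂ p₁₁ p₁₂ p₂₁ p₂₂ q₁₁ q₁₂ q₂₁ q₂₂ : ℂ → ℂ)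

namespace Frame

/-- On `O` the matrix is invertible with `dM = (p dz + q dz̄) M`, and `p`, `q` are locally
Hölder continuous. -/
structure IsOn (M : Frame) (O : Set ℂ) : Prop where
  p₁₁ : LocHol M.p₁₁
  p₁₂ : LocHol M.p₁₂
  p₂₁ : LocHol M.p₂₁
  p₂₂ : LocHol M.p₂₂
  q₁₁ : LocHol M.q₁₁
  q₁₂ : LocHol M.q₁₂
  q₂₁ : LocHol M.q₂₁
  q₂₂ : LocHol M.q₂₂
  u₁ : ∀ z ∈ O, HasWirtingerAt M.u₁ (M.p₁₁ z * M.u₁ z + M.p₁₂ z * M.u₂ z)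
    (M.q₁₁ z * M.u₁ z + M.q₁₂ z * M.u₂ z) z
  u₂ : ∀ z ∈ O, HasWirtingerAt M.u₂ (M.p₂₁ z * M.u₁ z + M.p₂₂ z * M.u₂ z)
    (M.q₂₁ z * M.u₁ z + M.q₂₂ z * M.u₂ z) z
  v₁ : ∀ z ∈ O, HasWirtingerAt M.v₁ (M.p₁₁ z * M.v₁ z + M.p₁₂ z * M.v₂ z)
    (M.q₁₁ z * M.v₁ z + M.q₁₂ z * M.v₂ z) z
  v₂ : ∀ z ∈ O, HasWirtingerAt M.v₂ (M.p₂₁ z * M.v₁ z + M.p₂₂ z * M.v₂ z)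
    (M.q₂₁ z * M.v₁ z + M.q₂₂ z * M.v₂ z) z
  det : ∀ z ∈ O, M.u₁ z * M.v₂ z - M.u₂ z * M.v₁ z ≠ 0

/-- The successor relation, in terms of the connection matrices. -/
structure IsSucc (O : Set ℂ) (M M' : Frame) : Prop where
  p₁₁ : ∀ z ∈ O, M'.p₁₁ z = M.p₁₁ z
  p₁₂ : ∀ z ∈ O, M'.p₁₂ z = -M.q₁₂ z
  q₂₁ : ∀ z ∈ O, M'.q₂₁ z = -M.p₂₁ z
  q₂₂ : ∀ z ∈ O, M'.q₂₂ z = M.q₂₂ z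

variable {O : Set ℂ} {M M' : Frame}

/-- The inverse transpose of a frame. -/
noncomputable def dual (M : Frame) : Frame where
  u₁ z := M.v₂ z * (M.u₁ z * M.v₂ z - M.u₂ z * M.v₁ z)⁻¹
  u₂ z := -M.v₁ z * (M.u₁ z * M.v₂ z - M.u₂ z * M.v₁ z)⁻¹
  v₁ z := -M.u₂ z * (M.u₁ z * M.v₂ z - M.u₂ z * M.v₁ z)⁻¹
  v₂ z := M.u₁ z * (M.u₁ z * M.v₂ z - M.u₂ z * M.v₁ z)⁻¹
  p₁₁ z := -M.p₁₁ z
  p₁₂ z := -M.p₂₁ z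
  p₂₁ z := -M.p₁₂ z
  p₂₂ z := -M.p₂₂ z
  q₁₁ z := -M.q₁₁ z
  q₁₂ z := -M.q₂₁ z
  q₂₁ z := -M.q₁₂ z
  q₂₂ z := -M.q₂₂ z

theorem IsOn.dual (h : M.IsOn O) : M.dual.IsOn O where
  p₁₁ := h.p₁₁.neg
  p₁₂ := h.p₂₁.neg
  p₂₁ := h.p₁₂.neg
  p₂₂ := h.p₂₂.neg
  q₁₁ := h.q₁₁.neg
  q₁₂ := h.q₂₁.neg
  q₂₁ := h.q₁₂.neg
  q₂₂ := h.q₂₂.neg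
  u₁ z hz := by
    have hd := h.det z hz
    have he := mul_inv_cancel₀ hd
    refine ((h.v₂ z hz).mul ((((h.u₁ z hz).mul (h.v₂ z hz)).sub
      ((h.u₂ z hz).mul (h.v₁ z hz))).inv hd)).congr_coeff ?_ ?_
    · simp only [Frame.dual, ← inv_pow]
      linear_combination
        (-M.v₂ z * (M.u₁ z * M.v₂ z - M.u₂ z * M.v₁ z)⁻¹ * (M.p₁₁ z + M.p₂₂ z)) * he
    · simp only [Frame.dual, ← inv_pow]
      linear_combination
        (-M.v₂ z * (M.u₁ z * M.v₂ z - M.u₂ z * M.v₁ z)⁻¹ * (M.q₁₁ z + M.q₂₂ z)) * he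
  u₂ z hz := by
    have hd := h.det z hz
    have he := mul_inv_cancel₀ hd
    refine ((h.v₁ z hz).neg.mul ((((h.u₁ z hz).mul (h.v₂ z hz)).sub
      ((h.u₂ z hz).mul (h.v₁ z hz))).inv hd)).congr_coeff ?_ ?_
    · simp only [Frame.dual, ← inv_pow]
      linear_combination
        (M.v₁ z * (M.u₁ z * M.v₂ z - M.u₂ z * M.v₁ z)⁻¹ * (M.p₁₁ z + M.p₂₂ z)) * he
    · simp only [Frame.dual, ← inv_pow]
      linear_combination
        (M.v₁ z * (M.u₁ z * M.v₂ z - M.u₂ z * M.v₁ z)⁻¹ * (M.q₁₁ z + M.q₂₂ z)) * he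
  v₁ z hz := by
    have hd := h.det z hz
    have he := mul_inv_cancel₀ hd
    refine ((h.u₂ z hz).neg.mul ((((h.u₁ z hz).mul (h.v₂ z hz)).sub
      ((h.u₂ z hz).mul (h.v₁ z hz))).inv hd)).congr_coeff ?_ ?_
    · simp only [Frame.dual, ← inv_pow]
      linear_combination
        (M.u₂ z * (M.u₁ z * M.v₂ z - M.u₂ z * M.v₁ z)⁻¹ * (M.p₁₁ z + M.p₂₂ z)) * he
    · simp only [Frame.dual, ← inv_pow]
      linear_combination
        (M.u₂ z * (M.u₁ z * M.v₂ z - M.u₂ z * M.v₁ z)⁻¹ * (M.q₁₁ z + M.q₂₂ z)) * he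
  v₂ z hz := by
    have hd := h.det z hz
    have he := mul_inv_cancel₀ hd
    refine ((h.u₁ z hz).mul ((((h.u₁ z hz).mul (h.v₂ z hz)).sub
      ((h.u₂ z hz).mul (h.v₁ z hz))).inv hd)).congr_coeff ?_ ?_
    · simp only [Frame.dual, ← inv_pow]
      linear_combination
        (-M.u₁ z * (M.u₁ z * M.v₂ z - M.u₂ z * M.v₁ z)⁻¹ * (M.p₁₁ z + M.p₂₂ z)) * he
    · simp only [Frame.dual, ← inv_pow]
      linear_combination
        (-M.u₁ z * (M.u₁ z * M.v₂ z - M.u₂ z * M.v₁ z)⁻¹ * (M.q₁₁ z + M.q₂₂ z)) * he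
  det z hz := by
    have hd := h.det z hz
    have : M.dual.u₁ z * M.dual.v₂ z - M.dual.u₂ z * M.dual.v₁ z =
        (M.u₁ z * M.v₂ z - M.u₂ z * M.v₁ z)⁻¹ := by
      simp only [Frame.dual]
      field_simp
    rw [this]
    exact inv_ne_zero hd

theorem IsSucc.dual (h : IsSucc O M.dual M') : IsSucc O M'.dual M where
  p₁₁ z hz := by simp [Frame.dual, h.p₁₁ z hz]
  p₁₂ z hz := by simp [Frame.dual, h.q₂₁ z hz]
  q₂₁ z hz := by simp [Frame.dual, h.p₁₂ z hz]
  q₂₂ z hz := by simp [Frame.dual, h.q₂₂ z hz]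

end Frame

theorem exists_cutoff {K U : Set ℂ} (hK : IsCompact K) (hne : K.Nonempty) (hU : IsOpen U)
    (hKU : K ⊆ U) : ∃ (φ : ℂ → ℂ) (L : ℝ) (S : Set ℂ), 0 ≤ L ∧ Bornology.IsBounded S ∧ S ⊆ U ∧
      (∀ x ∈ K, φ x = 1) ∧ (∀ x, x ∉ S → φ x = 0) ∧ ∀ x y, ‖φ x - φ y‖ ≤ L * ‖x - y‖ := by
  obtain ⟨δ, hδ, hsub⟩ := hK.exists_cthickening_subset_open hU hKU
  refine ⟨fun x => ((max 0 (1 - Metric.infDist x K / δ) : ℝ) : ℂ), δ⁻¹, Metric.cthickening δ K,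
    by positivity, hK.isBounded.cthickening, hsub, fun x hx => ?_, fun x hx => ?_, fun x y => ?_⟩
  · simp [Metric.infDist_zero_of_mem hx]
  · have h1 : δ < Metric.infDist x K := by
      by_contra hle
      refine hx (Metric.mem_cthickening_iff.2 ?_)
      rw [← ENNReal.ofReal_toReal (Metric.infEDist_ne_top hne)]
      exact ENNReal.ofReal_le_ofReal (not_lt.1 hle)
    have h2 : 1 - Metric.infDist x K / δ ≤ 0 := by
      rw [sub_nonpos, one_le_div hδ]
      exact h1.le
    simp [max_eq_left h2]
  · rw [← Complex.ofReal_sub, Complex.norm_real, Real.norm_eq_abs]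
    refine (abs_max_sub_max_le_max _ _ _ _).trans ?_
    have h1 : |Metric.infDist x K - Metric.infDist y K| ≤ ‖x - y‖ := by
      have h2 := Metric.infDist_le_infDist_add_dist (s := K) (x := x) (y := y)
      have h3 := Metric.infDist_le_infDist_add_dist (s := K) (x := y) (y := x)
      rw [dist_comm] at h3
      rw [dist_eq_norm] at h2 h3
      rw [abs_le]
      constructor <;> linarith
    rw [sub_self, abs_zero, max_eq_right (abs_nonneg _), sub_sub_sub_cancel_left, ← sub_div,
      abs_div, abs_of_pos hδ, div_eq_inv_mul, abs_sub_comm]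
    gcongr

theorem LocHol.cutoff {φ c : ℂ → ℂ} {S : Set ℂ} {L : ℝ} (hL : 0 ≤ L) (hS : Bornology.IsBounded S)
    (hφ : ∀ x, x ∉ S → φ x = 0) (hφL : ∀ x y, ‖φ x - φ y‖ ≤ L * ‖x - y‖) (hc : HolOn S c) :
    LocHol (fun x => φ x * c x) := by
  obtain ⟨B, hB, hcB⟩ := hc.exists_bound hS
  have hφS : HolOn S φ := HolOn.of_lipschitz hS hL fun x _ y _ => hφL x y
  obtain ⟨C, α, hC, hα, -, h⟩ := hφS.mul hS hc
  intro r
  refine HolOn.of_two_bounds Metric.isBounded_closedBall hC (mul_nonneg hL hB) hα one_pos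
    fun x _ y _ => ?_
  have h1 : 0 ≤ C * ‖x - y‖ ^ α := by positivity
  have h2 : 0 ≤ L * B * ‖x - y‖ := by positivity
  have key : ∀ x y, x ∈ S → y ∉ S → ‖φ x * c x - φ y * c y‖ ≤ L * B * ‖x - y‖ := by
    intro x y hx hy
    have h3 := hφL x y
    rw [hφ y hy, sub_zero] at h3
    rw [hφ y hy, zero_mul, sub_zero, norm_mul]
    calc ‖φ x‖ * ‖c x‖ ≤ L * ‖x - y‖ * B := by
          gcongr
          exact hcB x hx
      _ = _ := by ring
  rw [Real.rpow_one]
  by_cases hx : x ∈ S <;> by_cases hy : y ∈ S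
  · linarith [h x hx y hy]
  · linarith [key x y hx hy]
  · have := key y x hy hx
    rw [norm_sub_rev, norm_sub_rev y x] at this
    linarith
  · rw [hφ x hx, hφ y hy]
    simpa using add_nonneg h1 h2

section cramer

variable {u₁ u₂ v₁ v₂ a b c d : ℂ}

theorem cramer_left (h : u₁ * v₂ - u₂ * v₁ ≠ 0) (a b : ℂ) :
    (a * v₂ - b * u₂) * (u₁ * v₂ - u₂ * v₁)⁻¹ * u₁ +
      (b * u₁ - a * v₁) * (u₁ * v₂ - u₂ * v₁)⁻¹ * u₂ = a := by
  linear_combination a * mul_inv_cancel₀ h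

theorem cramer_right (h : u₁ * v₂ - u₂ * v₁ ≠ 0) (a b : ℂ) :
    (a * v₂ - b * u₂) * (u₁ * v₂ - u₂ * v₁)⁻¹ * v₁ +
      (b * u₁ - a * v₁) * (u₁ * v₂ - u₂ * v₁)⁻¹ * v₂ = b := by
  linear_combination b * mul_inv_cancel₀ h

theorem cramer_unique (h : u₁ * v₂ - u₂ * v₁ ≠ 0) (ha : a = c * u₁ + d * u₂)
    (hb : b = c * v₁ + d * v₂) :
    (a * v₂ - b * u₂) * (u₁ * v₂ - u₂ * v₁)⁻¹ = c ∧
      (b * u₁ - a * v₁) * (u₁ * v₂ - u₂ * v₁)⁻¹ = d := by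
  subst ha hb
  constructor
  · linear_combination c * mul_inv_cancel₀ h
  · linear_combination d * mul_inv_cancel₀ h

end cramer

namespace Frame

variable {O : Set ℂ} {M : Frame}

theorem IsOn.exists_isSucc (h : M.IsOn O) (hO : Bornology.IsBounded O) :
    ∃ M', IsOn M' O ∧ IsSucc O M M' := by
  obtain ⟨r, hr0, hr⟩ := hO.subset_closedBall_lt 0 0
  obtain ⟨φ, L, S, hL, hS, -, hφ1, hφ0, hφL⟩ := exists_cutoff (isCompact_closedBall (0 : ℂ) r)
    ⟨0, by simpa using hr0.le⟩ isOpen_univ (Set.subset_univ _)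
  have hφ : HolSupp φ := by
    obtain ⟨ρ, hρ⟩ := hS.subset_closedBall 0
    refine ⟨fun _ => HolOn.of_lipschitz Metric.isBounded_closedBall hL fun x _ y _ => hφL x y, ρ,
      fun x hx => hφ0 x fun hxS => ?_⟩
    have := hρ hxS
    rw [mem_closedBall_zero_iff] at this
    linarith
  obtain ⟨u₁, u₂, v₁, v₂, b₁, a₂, b₁', a₂', hu₁, hu₂, hv₁, hv₂, hdet⟩ :=
    exists_fundamental_system (hφ.mul ((LocHol.const 2).mul h.p₁₁))
      (hφ.mul ((LocHol.const (-2)).mul h.q₁₂)) (hφ.mul ((LocHol.const (-2)).mul h.p₂₁))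
      (hφ.mul ((LocHol.const 2).mul h.q₂₂))
  have hδ : LocHol (fun z => (u₁ z * v₂ z - u₂ z * v₁ z)⁻¹) :=
    ((hu₁.locHol.mul hv₂.locHol).sub (hu₂.locHol.mul hv₁.locHol)).inv hdet
  have hl : ∀ {a b : ℂ → ℂ}, LocHol a → LocHol b →
      LocHol (fun z => (a z * v₂ z - b z * u₂ z) * (u₁ z * v₂ z - u₂ z * v₁ z)⁻¹) :=
    fun ha hb => ((ha.mul hv₂.locHol).sub (hb.mul hu₂.locHol)).mul hδ
  have hr' : ∀ {a b : ℂ → ℂ}, LocHol a → LocHol b →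
      LocHol (fun z => (b z * u₁ z - a z * v₁ z) * (u₁ z * v₂ z - u₂ z * v₁ z)⁻¹) :=
    fun ha hb => ((hb.mul hu₁.locHol).sub (ha.mul hv₁.locHol)).mul hδ
  have hφO : ∀ z ∈ O, φ z = 1 := fun z hz => hφ1 z (hr hz)
  refine ⟨⟨u₁, u₂, v₁, v₂, _, _, _, _, _, _, _, _⟩,
    ⟨hl hu₁.left hv₁.left, hr' hu₁.left hv₁.left, hl hu₂.left hv₂.left, hr' hu₂.left hv₂.left,
      hl hu₁.right hv₁.right, hr' hu₁.right hv₁.right, hl hu₂.right hv₂.right,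
      hr' hu₂.right hv₂.right, fun z _ => (hu₁.deriv z).congr_coeff ?_ ?_,
      fun z _ => (hu₂.deriv z).congr_coeff ?_ ?_, fun z _ => (hv₁.deriv z).congr_coeff ?_ ?_,
      fun z _ => (hv₂.deriv z).congr_coeff ?_ ?_, fun z _ => hdet z⟩,
    ⟨fun z hz => ?_, fun z hz => ?_, fun z hz => ?_, fun z hz => ?_⟩⟩
  · exact (cramer_left (hdet z) _ _).symm
  · exact (cramer_left (hdet z) _ _).symm
  · exact (cramer_left (hdet z) _ _).symm
  · exact (cramer_left (hdet z) _ _).symm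
  · exact (cramer_right (hdet z) _ _).symm
  · exact (cramer_right (hdet z) _ _).symm
  · exact (cramer_right (hdet z) _ _).symm
  · exact (cramer_right (hdet z) _ _).symm
  · refine (cramer_unique (hdet z) (d := -M.q₁₂ z) ?_ ?_).1 <;>
    · simp only [hφO z hz]
      ring
  · refine (cramer_unique (hdet z) (c := M.p₁₁ z) ?_ ?_).2 <;>
    · simp only [hφO z hz]
      ring
  · refine (cramer_unique (hdet z) (d := M.q₂₂ z) ?_ ?_).1 <;>
    · simp only [hφO z hz]
      ring
  · refine (cramer_unique (hdet z) (c := -M.p₂₁ z) ?_ ?_).2 <;>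
    · simp only [hφO z hz]
      ring

theorem IsOn.exists_isSucc_left (h : M.IsOn O) (hO : Bornology.IsBounded O) :
    ∃ M', IsOn M' O ∧ IsSucc O M' M := by
  obtain ⟨M', h1, h2⟩ := h.dual.exists_isSucc hO
  exact ⟨M'.dual, h1.dual, h2.dual⟩

end Frame

theorem exists_int_seq {α : Type*} {r : α → α → Prop} (h₁ : ∀ a, ∃ b, r a b)
    (h₂ : ∀ b, ∃ a, r a b) (a₀ : α) : ∃ s : ℤ → α, s 0 = a₀ ∧ ∀ m, r (s m) (s (m + 1)) := by
  choose f hf using h₁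
  choose g hg using h₂
  refine ⟨fun m => Int.rec (fun n => f^[n] a₀) (fun n => g^[n + 1] a₀) m, rfl, fun m => ?_⟩
  rcases m with n | n
  · change r (f^[n] a₀) (f^[n + 1] a₀)
    rw [Function.iterate_succ_apply']
    exact hf _
  · rcases n with _ | n
    · exact hg a₀
    · change r (g^[n + 1 + 1] a₀) (g^[n + 1] a₀)
      rw [Function.iterate_succ_apply' g (n + 1)]
      exact hg _

namespace Bicomplex

/-- First idempotent component of a bicomplex number. -/
noncomputable def plus (q : Bicomplex) : ℂ := q.re - Complex.I * q.im

/-- Second idempotent component of a bicomplex number. -/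
noncomputable def minus (q : Bicomplex) : ℂ := q.re + Complex.I * q.im

theorem add_re (p q : Bicomplex) : (p + q).re = p.re + q.re := rfl
theorem add_im (p q : Bicomplex) : (p + q).im = p.im + q.im := rfl
theorem sub_re (p q : Bicomplex) : (p - q).re = p.re - q.re := rfl
theorem sub_im (p q : Bicomplex) : (p - q).im = p.im - q.im := rfl
theorem neg_re (q : Bicomplex) : (-q).re = -q.re := rfl
theorem neg_im (q : Bicomplex) : (-q).im = -q.im := rfl
theorem mul_re (p q : Bicomplex) : (p * q).re = p.re * q.re - p.im * q.im := rfl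
theorem mul_im (p q : Bicomplex) : (p * q).im = p.re * q.im + p.im * q.re := rfl

theorem ext_of_plus_minus {p q : Bicomplex} (h₁ : p.plus = q.plus) (h₂ : p.minus = q.minus) :
    p = q := by
  rw [plus, plus] at h₁
  rw [minus, minus] at h₂
  have hre : p.re = q.re := by linear_combination (h₁ + h₂) / 2
  have him : p.im = q.im := by
    linear_combination Complex.I / 2 * (h₁ - h₂) + (p.im - q.im) * Complex.I_mul_I
  cases p
  cases q
  simp_all

theorem plus_neg (q : Bicomplex) : (-q).plus = -q.plus := by
  rw [plus, plus, neg_re, neg_im]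
  ring

theorem minus_neg (q : Bicomplex) : (-q).minus = -q.minus := by
  rw [minus, minus, neg_re, neg_im]
  ring

/-- `(conj f * g).im` is, up to a factor, the determinant of the idempotent components. -/
theorem det_eq (f g : Bicomplex) :
    f.plus * g.minus - f.minus * g.plus = 2 * Complex.I * (conj f * g).im := by
  simp only [plus, minus, mul_im, conj]
  ring

/-- The pair `(a, b)` given by Cramer's rule solves `X = a f + b f̄`, `Y = a g + b ḡ`. -/
theorem coeff_spec {f g : Bicomplex} (h : (conj f * g).im ≠ 0) (X Y : Bicomplex)
    {a b : Bicomplex}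
    (ha : a = -((conj f * Y - X * conj g) * inv (f * conj g - conj f * g)))
    (hb : b = (f * Y - X * g) * inv (f * conj g - conj f * g)) :
    X = a * f + b * conj f ∧ Y = a * g + b * conj g := by
  have h' : f.re * g.im - f.im * g.re ≠ 0 := by
    intro h0
    apply h
    rw [mul_im, conj]
    linear_combination h0
  have hinv : inv (f * conj g - conj f * g) = ⟨0, (2 * (f.re * g.im - f.im * g.re))⁻¹⟩ := by
    have h1 : (f * conj g - conj f * g).re = 0 := by
      simp only [sub_re, mul_re, conj]
      ring
    have h2 : (f * conj g - conj f * g).im = -(2 * (f.re * g.im - f.im * g.re)) := by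
      simp only [sub_im, mul_im, conj]
      ring
    rw [inv, h1, h2]
    congr 1
    · simp
    · field_simp
      ring
  have he := mul_inv_cancel₀ (mul_ne_zero two_ne_zero h')
  rw [hinv] at ha hb
  generalize (2 * (f.re * g.im - f.im * g.re))⁻¹ = e at *
  have key : ∀ p q : Bicomplex, p.re = q.re → p.im = q.im → p = q := by
    rintro ⟨_, _⟩ ⟨_, _⟩ rfl rfl
    rfl
  subst ha hb
  constructor <;> refine key _ _ ?_ ?_ <;>
    simp only [add_re, add_im, sub_re, sub_im, neg_re, neg_im, mul_re, mul_im, conj]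
  · linear_combination -X.re * he
  · linear_combination -X.im * he
  · linear_combination -Y.re * he
  · linear_combination -Y.im * he

theorem coeff_spec_plus {X a b f : Bicomplex} (h : X = a * f + b * conj f) :
    X.plus = a.plus * f.plus + b.plus * f.minus ∧
      X.minus = b.minus * f.plus + a.minus * f.minus := by
  subst h
  simp only [plus, minus, add_re, add_im, mul_re, mul_im, conj]
  constructor
  · linear_combination (b.im * f.im - a.im * f.im) * Complex.I_mul_I
  · linear_combination (b.im * f.im - a.im * f.im) * Complex.I_mul_I

end Bicomplex

open Bicomplex

/-- Both systems satisfied by the idempotent components of a generating pair. -/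
theorem dbar_eq_of_generating {F G : ℝ × ℝ → Bicomplex} {x : ℝ × ℝ}
    (h : (conj (F x) * G x).im ≠ 0) :
    dbar F x = aCoef F G x * F x + bCoef F G x * conj (F x) ∧
      dbar G x = aCoef F G x * G x + bCoef F G x * conj (G x) :=
  coeff_spec h _ _ rfl rfl

theorem dz_eq_of_generating {F G : ℝ × ℝ → Bicomplex} {x : ℝ × ℝ}
    (h : (conj (F x) * G x).im ≠ 0) :
    dz F x = ACoef F G x * F x + BCoef F G x * conj (F x) ∧
      dz G x = ACoef F G x * G x + BCoef F G x * conj (G x) :=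
  coeff_spec h _ _ rfl rfl

theorem HasFDerivAt.pdx_eq {f : ℝ × ℝ → ℂ} {L : ℝ × ℝ →L[ℝ] ℂ} {x : ℝ × ℝ}
    (h : HasFDerivAt f L x) : pdx f x = L (1, 0) := by
  have h1 : HasDerivAt (fun t : ℝ => (t, x.2)) (1, 0) x.1 :=
    (hasDerivAt_id x.1).prodMk (hasDerivAt_const x.1 x.2)
  exact (h.comp_hasDerivAt x.1 h1).deriv

theorem HasFDerivAt.pdy_eq {f : ℝ × ℝ → ℂ} {L : ℝ × ℝ →L[ℝ] ℂ} {x : ℝ × ℝ}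
    (h : HasFDerivAt f L x) : pdy f x = L (0, 1) := by
  have h1 : HasDerivAt (fun t : ℝ => (x.1, t)) (0, 1) x.2 :=
    (hasDerivAt_const x.2 x.1).prodMk (hasDerivAt_id x.2)
  exact (h.comp_hasDerivAt x.2 h1).deriv

theorem hasWirtingerAt_of_differentiableAt {f : ℝ × ℝ → ℂ} {z : ℂ}
    (h : DifferentiableAt ℝ f (z.re, z.im)) :
    HasWirtingerAt (fun w => f (w.re, w.im))
      ((pdx f (z.re, z.im) - Complex.I * pdy f (z.re, z.im)) / 2)
      ((pdx f (z.re, z.im) + Complex.I * pdy f (z.re, z.im)) / 2) z := by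
  have hf := h.hasFDerivAt
  have hc : HasFDerivAt (fun w : ℂ => (w.re, w.im)) (Complex.reCLM.prod Complex.imCLM) z :=
    Complex.reCLM.hasFDerivAt.prodMk Complex.imCLM.hasFDerivAt
  refine .of_fderiv (hf.comp z hc) fun t => ?_
  rw [hf.pdx_eq, hf.pdy_eq]
  set L := fderiv ℝ f (z.re, z.im)
  have hL : L (t.re, t.im) = t.re * L (1, 0) + t.im * L (0, 1) := by
    have : ((t.re, t.im) : ℝ × ℝ) = t.re • (1, 0) + t.im • (0, 1) := by simp
    rw [this, map_add, map_smul, map_smul]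
    simp
  have ht : (t.re : ℂ) + t.im * Complex.I = t := Complex.re_add_im t
  have hc' : starRingEnd ℂ t = t.re - t.im * Complex.I := by
    apply Complex.ext <;> simp
  change L (t.re, t.im) = _
  rw [hL, hc']
  linear_combination ((L (1, 0) - Complex.I * L (0, 1)) / 2) * ht +
    t.im * L (0, 1) * Complex.I_mul_I

section idempotent

variable {F : ℝ × ℝ → Bicomplex} {z : ℂ}

theorem hasWirtingerAt_plus
    (h₀ : DifferentiableAt ℝ (fun x => (F x).re) (z.re, z.im))
    (h₁ : DifferentiableAt ℝ (fun x => (F x).im) (z.re, z.im)) :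
    HasWirtingerAt (fun w => (F (w.re, w.im)).plus) ((dbar F (z.re, z.im)).plus / 2)
      ((dz F (z.re, z.im)).plus / 2) z := by
  refine ((hasWirtingerAt_of_differentiableAt h₀).sub
    ((HasWirtingerAt.const Complex.I z).mul
      (hasWirtingerAt_of_differentiableAt h₁))).congr_coeff ?_ ?_
  · simp only [plus, dbar, bpdx, bpdy, k, add_re, add_im, mul_re, mul_im]
    linear_combination (pdy (fun x => (F x).im) (z.re, z.im) / 2) * Complex.I_mul_I
  · simp only [plus, dz, bpdx, bpdy, k, sub_re, sub_im, mul_re, mul_im]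
    linear_combination (-pdy (fun x => (F x).im) (z.re, z.im) / 2) * Complex.I_mul_I

theorem hasWirtingerAt_minus
    (h₀ : DifferentiableAt ℝ (fun x => (F x).re) (z.re, z.im))
    (h₁ : DifferentiableAt ℝ (fun x => (F x).im) (z.re, z.im)) :
    HasWirtingerAt (fun w => (F (w.re, w.im)).minus) ((dz F (z.re, z.im)).minus / 2)
      ((dbar F (z.re, z.im)).minus / 2) z := by
  refine ((hasWirtingerAt_of_differentiableAt h₀).add
    ((HasWirtingerAt.const Complex.I z).mul
      (hasWirtingerAt_of_differentiableAt h₁))).congr_coeff ?_ ?_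
  · simp only [minus, dz, bpdx, bpdy, k, sub_re, sub_im, mul_re, mul_im]
    linear_combination (-pdy (fun x => (F x).im) (z.re, z.im) / 2) * Complex.I_mul_I
  · simp only [minus, dbar, bpdx, bpdy, k, add_re, add_im, mul_re, mul_im]
    linear_combination (pdy (fun x => (F x).im) (z.re, z.im) / 2) * Complex.I_mul_I

end idempotent

theorem HasWirtingerAt.unique {u : ℂ → ℂ} {a b a' b' z : ℂ} (h : HasWirtingerAt u a b z)
    (h' : HasWirtingerAt u a' b' z) : a = a' ∧ b = b' := by
  have hL := HasFDerivAt.unique h h'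
  have h1 := DFunLike.congr_fun hL 1
  have h2 := DFunLike.congr_fun hL Complex.I
  rw [wirtinger_apply, wirtinger_apply] at h1 h2
  rw [Complex.conj_I] at h2
  rw [map_one] at h1
  constructor
  · linear_combination h1 / 2 - Complex.I / 2 * h2 + ((a - b - a' + b') / 2) * Complex.I_mul_I
  · linear_combination h1 / 2 + Complex.I / 2 * h2 - ((a - b - a' + b') / 2) * Complex.I_mul_I

/-- The bicomplex-valued function with idempotent components `u₁`, `u₂`. -/
noncomputable def ofComponents (u₁ u₂ : ℂ → ℂ) (x : ℝ × ℝ) : Bicomplex :=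
  ⟨(u₁ (Complex.equivRealProdCLM.symm x) + u₂ (Complex.equivRealProdCLM.symm x)) / 2,
    Complex.I * (u₁ (Complex.equivRealProdCLM.symm x) - u₂ (Complex.equivRealProdCLM.symm x)) / 2⟩

theorem plus_ofComponents (u₁ u₂ : ℂ → ℂ) (z : ℂ) :
    (ofComponents u₁ u₂ (z.re, z.im)).plus = u₁ z := by
  have : Complex.equivRealProdCLM.symm (z.re, z.im) = z := by
    apply Complex.ext <;> simp
  simp only [plus, ofComponents, this]
  linear_combination ((u₂ z - u₁ z) / 2) * Complex.I_mul_I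

theorem minus_ofComponents (u₁ u₂ : ℂ → ℂ) (z : ℂ) :
    (ofComponents u₁ u₂ (z.re, z.im)).minus = u₂ z := by
  have : Complex.equivRealProdCLM.symm (z.re, z.im) = z := by
    apply Complex.ext <;> simp
  simp only [minus, ofComponents, this]
  linear_combination ((u₁ z - u₂ z) / 2) * Complex.I_mul_I

theorem ofComponents_plus_minus (F : ℝ × ℝ → Bicomplex) (x : ℝ × ℝ) :
    ofComponents (fun z => (F (z.re, z.im)).plus) (fun z => (F (z.re, z.im)).minus) x = F x :=
  ext_of_plus_minus
    (plus_ofComponents _ _ (⟨x.1, x.2⟩ : ℂ)) (minus_ofComponents _ _ (⟨x.1, x.2⟩ : ℂ))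

theorem HolOn.of_holderOnWith {c : ℝ × ℝ → Bicomplex} {C α : NNReal} {Ω : Set (ℝ × ℝ)}
    (hα : 0 < α) (h : HolderOnWith C α (fun x => ((c x).re, (c x).im)) Ω) {S : Set ℂ}
    (hS : Bornology.IsBounded S) (hSΩ : ∀ z ∈ S, (z.re, z.im) ∈ Ω) :
    HolOn S (fun z => (c (z.re, z.im)).plus / 2) ∧
      HolOn S (fun z => (c (z.re, z.im)).minus / 2) := by
  have key : ∀ x ∈ S, ∀ y ∈ S,
      ‖(c (x.re, x.im)).re - (c (y.re, y.im)).re‖ ≤ C * ‖x - y‖ ^ (α : ℝ) ∧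
        ‖(c (x.re, x.im)).im - (c (y.re, y.im)).im‖ ≤ C * ‖x - y‖ ^ (α : ℝ) := by
    intro x hx y hy
    have h1 := h.dist_le_of_le (hSΩ x hx) (hSΩ y hy) (d := ‖x - y‖) (by
      rw [Prod.dist_eq]
      refine max_le ?_ ?_
      · rw [Real.dist_eq]
        exact Complex.abs_re_le_norm (x - y)
      · rw [Real.dist_eq]
        exact Complex.abs_im_le_norm (x - y))
    rw [Prod.dist_eq, max_le_iff, dist_eq_norm, dist_eq_norm] at h1
    exact h1
  have bound : ∀ p q : ℂ, ‖(p - Complex.I * q) / 2‖ ≤ ‖p‖ + ‖q‖ ∧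
      ‖(p + Complex.I * q) / 2‖ ≤ ‖p‖ + ‖q‖ := by
    intro p q
    have hq : ‖Complex.I * q‖ = ‖q‖ := by simp
    have := norm_nonneg p
    have := norm_nonneg q
    have := norm_sub_le p (Complex.I * q)
    have := norm_add_le p (Complex.I * q)
    rw [norm_div, norm_div, Complex.norm_two]
    constructor <;> linarith
  constructor <;>
    refine HolOn.of_two_bounds hS C.2 C.2 (NNReal.coe_pos.2 hα) (NNReal.coe_pos.2 hα)
      fun x hx y hy => ?_
  · refine le_trans (le_of_eq ?_)
      ((bound _ _).1.trans (add_le_add (key x hx y hy).1 (key x hx y hy).2))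
    congr 1
    simp only [plus]
    ring
  · refine le_trans (le_of_eq ?_)
      ((bound _ _).2.trans (add_le_add (key x hx y hy).1 (key x hx y hy).2))
    congr 1
    simp only [minus]
    ring

theorem BContDiffOn.differentiableAt {F : ℝ × ℝ → Bicomplex} {Ω : Set (ℝ × ℝ)} (hF : BContDiffOn 1 F Ω) (hΩ : IsOpen Ω)
    {x : ℝ × ℝ} (hx : x ∈ Ω) : DifferentiableAt ℝ (fun x => (F x).re) x ∧
      DifferentiableAt ℝ (fun x => (F x).im) x :=
  ⟨(hF.1.differentiableOn (by simp)).differentiableAt (hΩ.mem_nhds hx),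
    (hF.2.differentiableOn (by simp)).differentiableAt (hΩ.mem_nhds hx)⟩

/-- A generating pair with Hölder continuous characteristic coefficients gives a frame on every
relatively compact subdomain. -/
theorem exists_frame {Ω : Set (ℝ × ℝ)} (hΩ : IsOpen Ω) {F G : ℝ × ℝ → Bicomplex}
    (hFG : IsGeneratingPair F G Ω) {C α : NNReal} (hα : 0 < α)
    (ha : HolderOnWith C α (fun z => ((aCoef F G z).re, (aCoef F G z).im)) Ω)
    (hb : HolderOnWith C α (fun z => ((bCoef F G z).re, (bCoef F G z).im)) Ω)
    (hA : HolderOnWith C α (fun z => ((ACoef F G z).re, (ACoef F G z).im)) Ω)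
    (hB : HolderOnWith C α (fun z => ((BCoef F G z).re, (BCoef F G z).im)) Ω)
    {Ω₁ : Set (ℝ × ℝ)} (hne : Ω₁.Nonempty) (hbdd : Bornology.IsBounded Ω₁)
    (hcl : closure Ω₁ ⊆ Ω) :
    ∃ M : Frame, M.IsOn {z | (z.re, z.im) ∈ Ω₁} ∧ (M.u₁ = fun z => (F (z.re, z.im)).plus) ∧
      (M.u₂ = fun z => (F (z.re, z.im)).minus) ∧ (M.v₁ = fun z => (G (z.re, z.im)).plus) ∧
      M.v₂ = fun z => (G (z.re, z.im)).minus := by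
  have hcoord : Continuous fun z : ℂ => (z.re, z.im) := by fun_prop
  obtain ⟨φ, L, S, hL, hS, hSΩ, hφ1, hφ0, hφL⟩ := exists_cutoff
    (K := Complex.equivRealProdCLM.symm '' closure Ω₁) (U := {z | (z.re, z.im) ∈ Ω})
    (hbdd.isCompact_closure.image Complex.equivRealProdCLM.symm.continuous) (hne.closure.image _)
    (hΩ.preimage hcoord) (by
      rintro _ ⟨x, hx, rfl⟩
      simpa using hcl hx)
  have hφ : ∀ z : ℂ, (z.re, z.im) ∈ Ω₁ → φ z = 1 := fun z hz =>
    hφ1 z ⟨(z.re, z.im), subset_closure hz, by apply Complex.ext <;> simp⟩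
  have hsub : Ω₁ ⊆ Ω := subset_closure.trans hcl
  obtain ⟨ha₁, ha₂⟩ := HolOn.of_holderOnWith hα ha hS hSΩ
  obtain ⟨hb₁, hb₂⟩ := HolOn.of_holderOnWith hα hb hS hSΩ
  obtain ⟨hA₁, hA₂⟩ := HolOn.of_holderOnWith hα hA hS hSΩ
  obtain ⟨hB₁, hB₂⟩ := HolOn.of_holderOnWith hα hB hS hSΩ
  have dF := fun (z : ℂ) (hz : (z.re, z.im) ∈ Ω₁) => hFG.1.differentiableAt hΩ (hsub hz)
  have dG := fun (z : ℂ) (hz : (z.re, z.im) ∈ Ω₁) => hFG.2.1.differentiableAt hΩ (hsub hz)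
  have e₁ := fun (z : ℂ) (hz : (z.re, z.im) ∈ Ω₁) => dbar_eq_of_generating (hFG.2.2 _ (hsub hz))
  have e₂ := fun (z : ℂ) (hz : (z.re, z.im) ∈ Ω₁) => dz_eq_of_generating (hFG.2.2 _ (hsub hz))
  refine ⟨⟨fun z => (F (z.re, z.im)).plus, fun z => (F (z.re, z.im)).minus,
    fun z => (G (z.re, z.im)).plus, fun z => (G (z.re, z.im)).minus,
    fun z => φ z * ((aCoef F G (z.re, z.im)).plus / 2),
    fun z => φ z * ((bCoef F G (z.re, z.im)).plus / 2),
    fun z => φ z * ((BCoef F G (z.re, z.im)).minus / 2),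
    fun z => φ z * ((ACoef F G (z.re, z.im)).minus / 2),
    fun z => φ z * ((ACoef F G (z.re, z.im)).plus / 2),
    fun z => φ z * ((BCoef F G (z.re, z.im)).plus / 2),
    fun z => φ z * ((bCoef F G (z.re, z.im)).minus / 2),
    fun z => φ z * ((aCoef F G (z.re, z.im)).minus / 2)⟩,
    ⟨.cutoff hL hS hφ0 hφL ha₁, .cutoff hL hS hφ0 hφL hb₁, .cutoff hL hS hφ0 hφL hB₂,
      .cutoff hL hS hφ0 hφL hA₂, .cutoff hL hS hφ0 hφL hA₁, .cutoff hL hS hφ0 hφL hB₁,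
      .cutoff hL hS hφ0 hφL hb₂, .cutoff hL hS hφ0 hφL ha₂, fun z hz => ?_, fun z hz => ?_,
      fun z hz => ?_, fun z hz => ?_, fun z hz => ?_⟩, rfl, rfl, rfl, rfl⟩
  · refine (hasWirtingerAt_plus (dF z hz).1 (dF z hz).2).congr_coeff ?_ ?_
    · rw [(coeff_spec_plus (e₁ z hz).1).1]
      simp only [hφ z hz]
      ring
    · rw [(coeff_spec_plus (e₂ z hz).1).1]
      simp only [hφ z hz]
      ring
  · refine (hasWirtingerAt_minus (dF z hz).1 (dF z hz).2).congr_coeff ?_ ?_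
    · rw [(coeff_spec_plus (e₂ z hz).1).2]
      simp only [hφ z hz]
      ring
    · rw [(coeff_spec_plus (e₁ z hz).1).2]
      simp only [hφ z hz]
      ring
  · refine (hasWirtingerAt_plus (dG z hz).1 (dG z hz).2).congr_coeff ?_ ?_
    · rw [(coeff_spec_plus (e₁ z hz).2).1]
      simp only [hφ z hz]
      ring
    · rw [(coeff_spec_plus (e₂ z hz).2).1]
      simp only [hφ z hz]
      ring
  · refine (hasWirtingerAt_minus (dG z hz).1 (dG z hz).2).congr_coeff ?_ ?_
    · rw [(coeff_spec_plus (e₂ z hz).2).2]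
      simp only [hφ z hz]
      ring
    · rw [(coeff_spec_plus (e₁ z hz).2).2]
      simp only [hφ z hz]
      ring
  · rw [det_eq]
    exact mul_ne_zero (mul_ne_zero two_ne_zero Complex.I_ne_zero) (hFG.2.2 _ (hsub hz))

theorem contDiffOn_of_hasWirtingerAt {O : Set ℂ} (hO : IsOpen O) {u a b : ℂ → ℂ}
    (h : ∀ z ∈ O, HasWirtingerAt u (a z) (b z) z) (ha : ContinuousOn a O)
    (hb : ContinuousOn b O) : ContDiffOn ℝ 1 u O := by
  rw [show (1 : WithTop ℕ∞) = 0 + 1 from rfl, contDiffOn_succ_iff_fderiv_of_isOpen hO]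
  refine ⟨fun z hz => (h z hz).differentiableAt.differentiableWithinAt, by simp, ?_⟩
  rw [contDiffOn_zero]
  refine ContinuousOn.congr ?_ fun z hz => (h z hz).fderiv
  exact (ha.smul continuousOn_const).add (hb.smul continuousOn_const)

theorem BContDiffOn.ofComponents {Ω : Set (ℝ × ℝ)} {u₁ u₂ : ℂ → ℂ}
    (h₁ : ContDiffOn ℝ 1 u₁ {z | (z.re, z.im) ∈ Ω})
    (h₂ : ContDiffOn ℝ 1 u₂ {z | (z.re, z.im) ∈ Ω}) : BContDiffOn 1 (ofComponents u₁ u₂) Ω := by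
  have hm : Set.MapsTo Complex.equivRealProdCLM.symm Ω {z : ℂ | (z.re, z.im) ∈ Ω} := by
    intro x hx
    simpa using hx
  have g₁ := h₁.comp (Complex.equivRealProdCLM.symm.contDiff (n := 1)).contDiffOn hm
  have g₂ := h₂.comp (Complex.equivRealProdCLM.symm.contDiff (n := 1)).contDiffOn hm
  exact ⟨(g₁.add g₂).div_const 2, (contDiffOn_const.mul (g₁.sub g₂)).div_const 2⟩

namespace Frame

variable {M M' : Frame} {Ω : Set (ℝ × ℝ)}

theorem IsOn.isGeneratingPair (h : M.IsOn {z | (z.re, z.im) ∈ Ω}) (hΩ : IsOpen Ω) :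
    IsGeneratingPair (ofComponents M.u₁ M.u₂) (ofComponents M.v₁ M.v₂) Ω := by
  have hcoord : Continuous fun z : ℂ => (z.re, z.im) := by fun_prop
  have hO : IsOpen {z : ℂ | (z.re, z.im) ∈ Ω} := hΩ.preimage hcoord
  have cont : ∀ {u : ℂ → ℂ} {a b : ℂ → ℂ},
      (∀ z ∈ {z : ℂ | (z.re, z.im) ∈ Ω}, HasWirtingerAt u (a z) (b z) z) →
      ContinuousOn u {z : ℂ | (z.re, z.im) ∈ Ω} := fun hu z hz =>
    (hu z hz).continuousAt.continuousWithinAt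
  have comb : ∀ {s t u v : ℂ → ℂ}, LocHol s → LocHol t →
      ContinuousOn u {z : ℂ | (z.re, z.im) ∈ Ω} → ContinuousOn v {z : ℂ | (z.re, z.im) ∈ Ω} →
      ContinuousOn (fun z => s z * u z + t z * v z) {z : ℂ | (z.re, z.im) ∈ Ω} :=
    fun hs ht hu hv => (hs.continuous.continuousOn.mul hu).add (ht.continuous.continuousOn.mul hv)
  have u₁ := cont h.u₁
  have u₂ := cont h.u₂
  have v₁ := cont h.v₁
  have v₂ := cont h.v₂
  refine ⟨.ofComponents
      (contDiffOn_of_hasWirtingerAt hO h.u₁ (comb h.p₁₁ h.p₁₂ u₁ u₂) (comb h.q₁₁ h.q₁₂ u₁ u₂))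
      (contDiffOn_of_hasWirtingerAt hO h.u₂ (comb h.p₂₁ h.p₂₂ u₁ u₂) (comb h.q₂₁ h.q₂₂ u₁ u₂)),
    .ofComponents
      (contDiffOn_of_hasWirtingerAt hO h.v₁ (comb h.p₁₁ h.p₁₂ v₁ v₂) (comb h.q₁₁ h.q₁₂ v₁ v₂))
      (contDiffOn_of_hasWirtingerAt hO h.v₂ (comb h.p₂₁ h.p₂₂ v₁ v₂) (comb h.q₂₁ h.q₂₂ v₁ v₂)),
    fun x hx h0 => ?_⟩
  have hd := det_eq (ofComponents M.u₁ M.u₂ x) (ofComponents M.v₁ M.v₂ x)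
  have e₁ := fun u₁ u₂ => plus_ofComponents u₁ u₂ (⟨x.1, x.2⟩ : ℂ)
  have e₂ := fun u₁ u₂ => minus_ofComponents u₁ u₂ (⟨x.1, x.2⟩ : ℂ)
  rw [h0, e₁, e₁, e₂, e₂, mul_zero] at hd
  exact h.det ⟨x.1, x.2⟩ hx hd

/-- The characteristic coefficients of the generating pair attached to a frame. -/
theorem IsOn.coef_eq (h : M.IsOn {z | (z.re, z.im) ∈ Ω}) (hΩ : IsOpen Ω) {z : ℂ}
    (hz : (z.re, z.im) ∈ Ω) :
    (aCoef (ofComponents M.u₁ M.u₂) (ofComponents M.v₁ M.v₂) (z.re, z.im)).plus = 2 * M.p₁₁ z ∧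
    (bCoef (ofComponents M.u₁ M.u₂) (ofComponents M.v₁ M.v₂) (z.re, z.im)).plus = 2 * M.p₁₂ z ∧
    (aCoef (ofComponents M.u₁ M.u₂) (ofComponents M.v₁ M.v₂) (z.re, z.im)).minus = 2 * M.q₂₂ z ∧
    (bCoef (ofComponents M.u₁ M.u₂) (ofComponents M.v₁ M.v₂) (z.re, z.im)).minus = 2 * M.q₂₁ z ∧
    (BCoef (ofComponents M.u₁ M.u₂) (ofComponents M.v₁ M.v₂) (z.re, z.im)).plus = 2 * M.q₁₂ z ∧
    (BCoef (ofComponents M.u₁ M.u₂) (ofComponents M.v₁ M.v₂) (z.re, z.im)).minus =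
      2 * M.p₂₁ z := by
  obtain ⟨hF, hG, hdet⟩ := h.isGeneratingPair hΩ
  have dF := hF.differentiableAt hΩ hz
  have dG := hG.differentiableAt hΩ hz
  have wF₁ := hasWirtingerAt_plus dF.1 dF.2
  have wF₂ := hasWirtingerAt_minus dF.1 dF.2
  have wG₁ := hasWirtingerAt_plus dG.1 dG.2
  have wG₂ := hasWirtingerAt_minus dG.1 dG.2
  have e₁ := dbar_eq_of_generating (hdet _ hz)
  have e₂ := dz_eq_of_generating (hdet _ hz)
  have sF₁ := coeff_spec_plus e₁.1
  have sG₁ := coeff_spec_plus e₁.2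
  have sF₂ := coeff_spec_plus e₂.1
  have sG₂ := coeff_spec_plus e₂.2
  simp only [plus_ofComponents, minus_ofComponents] at wF₁ wF₂ wG₁ wG₂ sF₁ sF₂ sG₁ sG₂
  rw [sF₁.1, sF₂.1] at wF₁
  rw [sG₁.1, sG₂.1] at wG₁
  rw [sF₁.2, sF₂.2] at wF₂
  rw [sG₁.2, sG₂.2] at wG₂
  have tF₁ := wF₁.unique (h.u₁ z hz)
  have tF₂ := wF₂.unique (h.u₂ z hz)
  have tG₁ := wG₁.unique (h.v₁ z hz)
  have tG₂ := wG₂.unique (h.v₂ z hz)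
  have solve : ∀ {s t s' t' : ℂ}, (s * M.u₁ z + t * M.u₂ z) / 2 = s' * M.u₁ z + t' * M.u₂ z →
      (s * M.v₁ z + t * M.v₂ z) / 2 = s' * M.v₁ z + t' * M.v₂ z → s = 2 * s' ∧ t = 2 * t' := by
    intro s t s' t' hu hv
    have h1 := cramer_unique (c := s) (d := t) (h.det z hz) rfl rfl
    have h2 := cramer_unique (c := 2 * s') (d := 2 * t') (h.det z hz)
      (a := s * M.u₁ z + t * M.u₂ z) (b := s * M.v₁ z + t * M.v₂ z)
      (by linear_combination 2 * hu) (by linear_combination 2 * hv)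
    exact ⟨h1.1.symm.trans h2.1, h1.2.symm.trans h2.2⟩
  obtain ⟨r₁, r₂⟩ := solve tF₁.1 tG₁.1
  obtain ⟨r₃, r₄⟩ := solve tF₂.2 tG₂.2
  exact ⟨r₁, r₂, r₄, r₃, (solve tF₁.2 tG₁.2).2, (solve tF₂.1 tG₂.1).1⟩

theorem IsSucc.coef_eq (hs : IsSucc {z | (z.re, z.im) ∈ Ω} M M')
    (h : M.IsOn {z | (z.re, z.im) ∈ Ω}) (h' : M'.IsOn {z | (z.re, z.im) ∈ Ω}) (hΩ : IsOpen Ω)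
    {x : ℝ × ℝ} (hx : x ∈ Ω) :
    aCoef (ofComponents M'.u₁ M'.u₂) (ofComponents M'.v₁ M'.v₂) x =
      aCoef (ofComponents M.u₁ M.u₂) (ofComponents M.v₁ M.v₂) x ∧
    bCoef (ofComponents M'.u₁ M'.u₂) (ofComponents M'.v₁ M'.v₂) x =
      -BCoef (ofComponents M.u₁ M.u₂) (ofComponents M.v₁ M.v₂) x := by
  have hz : ((⟨x.1, x.2⟩ : ℂ).re, (⟨x.1, x.2⟩ : ℂ).im) ∈ Ω := hx
  obtain ⟨h₁, -, h₃, -, h₅, h₆⟩ := h.coef_eq hΩ hz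
  obtain ⟨h₁', h₂', h₃', h₄', -, -⟩ := h'.coef_eq hΩ hz
  refine ⟨ext_of_plus_minus (h₁'.trans ?_) (h₃'.trans ?_),
    ext_of_plus_minus (h₂'.trans ?_) (h₄'.trans ?_)⟩
  · rw [hs.p₁₁ _ hz, ← h₁]
  · rw [hs.q₂₂ _ hz, ← h₃]
  · rw [plus_neg, hs.p₁₂ _ hz, mul_neg, ← h₅]
  · rw [minus_neg, hs.q₂₁ _ hz, mul_neg, ← h₆]

end Frame

/-- embedding in a generating sequence: a generating pair `(F,G)` on Ω
(C¹ with Hölder-continuous characteristic coefficients) can be embedded, on any bounded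
domain Ω₁ with closure contained in Ω, in a generating sequence `{(F_m,G_m)}, m ∈ ℤ`,
i.e. `(F₀,G₀) = (F,G)` on Ω₁ and each `(F_{m+1},G_{m+1})` is a successor of
`(F_m,G_m)` on Ω₁. -/
theorem embedding_in_generating_sequence
    (Ω : Set (ℝ × ℝ)) (hΩo : IsOpen Ω) (hΩc : IsConnected Ω)
    (F G : ℝ × ℝ → Bicomplex) (hFG : IsGeneratingPair F G Ω)
    (hHolder : ∃ (C α : NNReal), 0 < α ∧ α ≤ 1 ∧
      HolderOnWith C α (fun z => ((aCoef F G z).re, (aCoef F G z).im)) Ω ∧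
      HolderOnWith C α (fun z => ((bCoef F G z).re, (bCoef F G z).im)) Ω ∧
      HolderOnWith C α (fun z => ((ACoef F G z).re, (ACoef F G z).im)) Ω ∧
      HolderOnWith C α (fun z => ((BCoef F G z).re, (BCoef F G z).im)) Ω)
    (Ω₁ : Set (ℝ × ℝ)) (hΩ₁o : IsOpen Ω₁) (hΩ₁c : IsConnected Ω₁)
    (hΩ₁b : Bornology.IsBounded Ω₁) (hΩ₁cl : closure Ω₁ ⊆ Ω) :
    ∃ Fm Gm : ℤ → ℝ × ℝ → Bicomplex,
      (∀ z ∈ Ω₁, Fm 0 z = F z ∧ Gm 0 z = G z) ∧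
      (∀ m : ℤ, IsGeneratingPair (Fm m) (Gm m) Ω₁) ∧
      (∀ m : ℤ, ∀ z ∈ Ω₁,
        aCoef (Fm (m + 1)) (Gm (m + 1)) z = aCoef (Fm m) (Gm m) z ∧
        bCoef (Fm (m + 1)) (Gm (m + 1)) z = -BCoef (Fm m) (Gm m) z) := by
  obtain ⟨C, α, hα, -, ha, hb, hA, hB⟩ := hHolder
  obtain ⟨M, hM, hu₁, hu₂, hv₁, hv₂⟩ :=
    exists_frame hΩo hFG hα ha hb hA hB hΩ₁c.nonempty hΩ₁b hΩ₁cl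
  set O : Set ℂ := {z | (z.re, z.im) ∈ Ω₁}
  have hO : Bornology.IsBounded O := by
    refine (Complex.equivRealProdCLM.symm.lipschitz.isBounded_image hΩ₁b).subset fun z hz => ?_
    exact ⟨(z.re, z.im), hz, by apply Complex.ext <;> simp⟩
  obtain ⟨s, hs₀, hs⟩ := exists_int_seq
    (r := fun M M' : {M : Frame // M.IsOn O} => Frame.IsSucc O M.1 M'.1)
    (fun M => by
      obtain ⟨M', h, hs⟩ := M.2.exists_isSucc hO
      exact ⟨⟨M', h⟩, hs⟩)
    (fun M => by
      obtain ⟨M', h, hs⟩ := M.2.exists_isSucc_left hO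
      exact ⟨⟨M', h⟩, hs⟩) ⟨M, hM⟩
  refine ⟨fun m => ofComponents (s m).1.u₁ (s m).1.u₂, fun m => ofComponents (s m).1.v₁ (s m).1.v₂,
    fun x _ => ?_, fun m => (s m).2.isGeneratingPair hΩ₁o,
    fun m x hx => (hs m).coef_eq (s m).2 (s (m + 1)).2 hΩ₁o hx⟩
  simp only [hs₀, hu₁, hu₂, hv₁, hv₂]
  exact ⟨ofComponents_plus_minus F x, ofComponents_plus_minus G x⟩
end

section
/- Let ν : ℝ → ℂ be continuous, ω ∈ ℂ, and let f0 : ℝ → ℂ be a twice continuously differentiable nonvanishing solution of the ordinary differential equation −f0″ + ν·f0 = 0. Define F0(x,y) = f0(x)·e^{iωy} on a domain Ω ⊆ ℝ². If W = W₁ + W₂·k (W₁, W₂ : Ω → ℂ twice continuously differentiable) is a solution of the bicomplex Vekua equation ∂̄W = (∂̄F0/F0)·W̄ in Ω, then f = Sc(W) = W₁ satisfies the Schrödinger equation −Δf + ν·f = ω²·f in Ω. -/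
open MeasureTheory

/-- `∂̄F0/F0 = (∂F0/∂x)/F0 + k·(∂F0/∂y)/F0` as a bicomplex-valued function -/
noncomputable def dbarLogQuot (F0 : ℝ × ℝ → ℂ) (p : ℝ × ℝ) : Bicomplex :=
  ⟨pdx F0 p / F0 p, pdy F0 p / F0 p⟩

open Topology in
/-- Restriction to a horizontal line preserves eventual statements. -/
theorem Filter.Eventually.fst_slice {P : ℝ × ℝ → Prop} {p : ℝ × ℝ} (h : ∀ᶠ q in 𝓝 p, P q) :
    ∀ᶠ t in 𝓝 p.1, P (t, p.2) :=
  (show ContinuousAt (fun t : ℝ => (t, p.2)) p.1 by fun_prop).eventually h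

open Topology in
/-- Restriction to a vertical line preserves eventual statements. -/
theorem Filter.Eventually.snd_slice {P : ℝ × ℝ → Prop} {p : ℝ × ℝ} (h : ∀ᶠ q in 𝓝 p, P q) :
    ∀ᶠ t in 𝓝 p.2, P (p.1, t) :=
  (show ContinuousAt (fun t : ℝ => (p.1, t)) p.2 by fun_prop).eventually h

open Topology in
theorem pdx_congr {f g : ℝ × ℝ → ℂ} {p : ℝ × ℝ} (h : f =ᶠ[𝓝 p] g) : pdx f p = pdx g p :=
  Filter.EventuallyEq.deriv_eq (Filter.Eventually.fst_slice h)

open Topology in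
theorem pdy_congr {f g : ℝ × ℝ → ℂ} {p : ℝ × ℝ} (h : f =ᶠ[𝓝 p] g) : pdy f p = pdy g p :=
  Filter.EventuallyEq.deriv_eq (Filter.Eventually.snd_slice h)

theorem HasFDerivAt.hasDerivAt_fst_slice {f : ℝ × ℝ → ℂ} {p : ℝ × ℝ} {L : ℝ × ℝ →L[ℝ] ℂ}
    (h : HasFDerivAt f L p) : HasDerivAt (fun t => f (t, p.2)) (L (1, 0)) p.1 :=
  HasFDerivAt.comp_hasDerivAt (x := p.1) (f := fun t : ℝ => (t, p.2)) h
    ((hasDerivAt_id p.1).prodMk (hasDerivAt_const p.1 p.2))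

theorem HasFDerivAt.hasDerivAt_snd_slice {f : ℝ × ℝ → ℂ} {p : ℝ × ℝ} {L : ℝ × ℝ →L[ℝ] ℂ}
    (h : HasFDerivAt f L p) : HasDerivAt (fun t => f (p.1, t)) (L (0, 1)) p.2 :=
  HasFDerivAt.comp_hasDerivAt (x := p.2) (f := fun t : ℝ => (p.1, t)) h
    ((hasDerivAt_const p.2 p.1).prodMk (hasDerivAt_id p.2))

theorem DifferentiableAt.pdx_eq_fderiv {f : ℝ × ℝ → ℂ} {p : ℝ × ℝ}
    (h : DifferentiableAt ℝ f p) : pdx f p = fderiv ℝ f p (1, 0) :=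
  h.hasFDerivAt.hasDerivAt_fst_slice.deriv

theorem DifferentiableAt.pdy_eq_fderiv {f : ℝ × ℝ → ℂ} {p : ℝ × ℝ}
    (h : DifferentiableAt ℝ f p) : pdy f p = fderiv ℝ f p (0, 1) :=
  h.hasFDerivAt.hasDerivAt_snd_slice.deriv

theorem DifferentiableAt.hasDerivAt_pdx {f : ℝ × ℝ → ℂ} {p : ℝ × ℝ}
    (h : DifferentiableAt ℝ f p) : HasDerivAt (fun t => f (t, p.2)) (pdx f p) p.1 :=
  h.hasFDerivAt.hasDerivAt_fst_slice.differentiableAt.hasDerivAt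

theorem DifferentiableAt.hasDerivAt_pdy {f : ℝ × ℝ → ℂ} {p : ℝ × ℝ}
    (h : DifferentiableAt ℝ f p) : HasDerivAt (fun t => f (p.1, t)) (pdy f p) p.2 :=
  h.hasFDerivAt.hasDerivAt_snd_slice.differentiableAt.hasDerivAt

open Topology in
theorem ContDiffAt.eventually_differentiableAt_of_two {f : ℝ × ℝ → ℂ} {p : ℝ × ℝ}
    (h : ContDiffAt ℝ 2 f p) : ∀ᶠ q in 𝓝 p, DifferentiableAt ℝ f q :=
  (h.eventually (by simp)).mono fun _ hq => hq.differentiableAt (by simp)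

theorem ContDiffAt.differentiableAt_fderiv_of_two {f : ℝ × ℝ → ℂ} {p : ℝ × ℝ}
    (h : ContDiffAt ℝ 2 f p) : DifferentiableAt ℝ (fderiv ℝ f) p :=
  (h.fderiv_right (m := 1) (by norm_num)).differentiableAt (by simp)

open Topology in
theorem ContDiffAt.pdx_eventuallyEq {f : ℝ × ℝ → ℂ} {p : ℝ × ℝ}
    (h : ContDiffAt ℝ 2 f p) : pdx f =ᶠ[𝓝 p] fun q => fderiv ℝ f q (1, 0) :=
  h.eventually_differentiableAt_of_two.mono fun _ hq => hq.pdx_eq_fderiv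

open Topology in
theorem ContDiffAt.pdy_eventuallyEq {f : ℝ × ℝ → ℂ} {p : ℝ × ℝ}
    (h : ContDiffAt ℝ 2 f p) : pdy f =ᶠ[𝓝 p] fun q => fderiv ℝ f q (0, 1) :=
  h.eventually_differentiableAt_of_two.mono fun _ hq => hq.pdy_eq_fderiv

theorem ContDiffAt.differentiableAt_pdx {f : ℝ × ℝ → ℂ} {p : ℝ × ℝ}
    (h : ContDiffAt ℝ 2 f p) : DifferentiableAt ℝ (pdx f) p :=
  (h.differentiableAt_fderiv_of_two.clm_apply
    (differentiableAt_const _)).congr_of_eventuallyEq h.pdx_eventuallyEq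

theorem ContDiffAt.differentiableAt_pdy {f : ℝ × ℝ → ℂ} {p : ℝ × ℝ}
    (h : ContDiffAt ℝ 2 f p) : DifferentiableAt ℝ (pdy f) p :=
  (h.differentiableAt_fderiv_of_two.clm_apply
    (differentiableAt_const _)).congr_of_eventuallyEq h.pdy_eventuallyEq

/-- Mixed partial derivatives of a `C²` function commute. -/
theorem ContDiffAt.pdx_pdy_comm {f : ℝ × ℝ → ℂ} {p : ℝ × ℝ}
    (h : ContDiffAt ℝ 2 f p) : pdx (pdy f) p = pdy (pdx f) p := by
  have hd := h.differentiableAt_fderiv_of_two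
  have hsymm : IsSymmSndFDerivAt ℝ f p := h.isSymmSndFDerivAt (by simp)
  rw [pdx_congr h.pdy_eventuallyEq, pdy_congr h.pdx_eventuallyEq,
    (hd.clm_apply (differentiableAt_const _)).pdx_eq_fderiv,
    (hd.clm_apply (differentiableAt_const _)).pdy_eq_fderiv,
    fderiv_clm_apply hd (differentiableAt_const _), fderiv_clm_apply hd (differentiableAt_const _)]
  simpa using hsymm (1, 0) (0, 1)

/-- The coefficient of the Vekua equation for `F0(x,y) = f0(x)e^{cy}`. -/
theorem dbarLogQuot_mul_exp {f0 : ℝ → ℂ} (hf0 : Differentiable ℝ f0) (hf0ne : ∀ x, f0 x ≠ 0)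
    (c : ℂ) (p : ℝ × ℝ) :
    dbarLogQuot (fun q => f0 q.1 * Complex.exp (c * q.2)) p = ⟨deriv f0 p.1 / f0 p.1, c⟩ := by
  have hexp : HasDerivAt (fun t : ℝ => Complex.exp (c * t)) (Complex.exp (c * p.2) * c) p.2 := by
    simpa using ((Complex.ofRealCLM.hasDerivAt (x := p.2)).const_mul c).cexp
  have hx : pdx (fun q => f0 q.1 * Complex.exp (c * q.2)) p =
      deriv f0 p.1 * Complex.exp (c * p.2) :=
    ((hf0 p.1).hasDerivAt.mul_const (Complex.exp (c * p.2))).deriv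
  have hy : pdy (fun q => f0 q.1 * Complex.exp (c * q.2)) p =
      f0 p.1 * (Complex.exp (c * p.2) * c) :=
    (hexp.const_mul (f0 p.1)).deriv
  have hne := hf0ne p.1
  have hene := Complex.exp_ne_zero (c * p.2)
  rw [dbarLogQuot, hx, hy]
  congr 1 <;> field_simp

/-- The logarithmic derivative `a = f'/f` satisfies the Riccati equation `a' = f''/f - a²`. -/
theorem ContDiff.hasDerivAt_deriv_div_self {f : ℝ → ℂ} (hf : ContDiff ℝ 2 f) {x : ℝ}
    (hx : f x ≠ 0) :
    HasDerivAt (fun t => deriv f t / f t)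
      (deriv (deriv f) x / f x - (deriv f x / f x) ^ 2) x := by
  have h1 : HasDerivAt f (deriv f x) x := (hf.differentiable (by simp) x).hasDerivAt
  have h2 : HasDerivAt (deriv f) (deriv (deriv f) x) x :=
    ((hf.iterate_deriv' 1 1).differentiable (by simp) x).hasDerivAt
  refine (h2.div h1 hx).congr_deriv ?_
  field_simp

/-- if `f0` is a nonvanishing solution of `−f0″ + ν f0 = 0` and
`F0(x,y) = f0(x)e^{iωy}`, then the scalar part of any solution of the Vekua equation
`∂̄W = (∂̄F0/F0)·W̄` solves the Schrödinger equation `−Δf + ν f = ω² f` in Ω. -/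
theorem Schroedinger_from_ODE_solution
    (Ω : Set (ℝ × ℝ)) (hΩo : IsOpen Ω) (hΩc : IsConnected Ω)
    (ν : ℝ → ℂ) (hν : Continuous ν) (ω : ℂ)
    (f0 : ℝ → ℂ) (hf0 : ContDiff ℝ 2 f0) (hf0ne : ∀ x, f0 x ≠ 0)
    (hODE : ∀ x, -deriv (deriv f0) x + ν x * f0 x = 0)
    (W₁ W₂ : ℝ × ℝ → ℂ)
    (hW₁ : ContDiffOn ℝ 2 W₁ Ω) (hW₂ : ContDiffOn ℝ 2 W₂ Ω)
    (hVek : ∀ p ∈ Ω,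
      dbar (fun q => (⟨W₁ q, W₂ q⟩ : Bicomplex)) p =
        dbarLogQuot (fun q => f0 q.1 * Complex.exp (Complex.I * ω * q.2)) p *
          Bicomplex.conj ⟨W₁ p, W₂ p⟩) :
    ∀ p ∈ Ω, -lap W₁ p + ν p.1 * W₁ p = ω ^ 2 * W₁ p := by
  intro p hp
  set b : ℂ := Complex.I * ω with hb
  let a : ℝ → ℂ := fun x => deriv f0 x / f0 x
  have hsys : ∀ q ∈ Ω, pdx W₁ q = pdy W₂ q + a q.1 * W₁ q + b * W₂ q ∧
      pdy W₁ q = b * W₁ q - a q.1 * W₂ q - pdx W₂ q := by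
    intro q hq
    have h := hVek q hq
    rw [dbarLogQuot_mul_exp (hf0.differentiable (by simp)) hf0ne] at h
    have hre : pdx W₁ q + (0 * pdy W₁ q - 1 * pdy W₂ q) = a q.1 * W₁ q - b * -W₂ q :=
      congrArg Bicomplex.re h
    have him : pdx W₂ q + (0 * pdy W₂ q + 1 * pdy W₁ q) = a q.1 * -W₂ q + b * W₁ q :=
      congrArg Bicomplex.im h
    exact ⟨by linear_combination hre, by linear_combination him⟩
  have hΩ : Ω ∈ nhds p := hΩo.mem_nhds hp
  have h₁ := hW₁.contDiffAt hΩ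
  have h₂ := hW₂.contDiffAt hΩ
  have d₁ : DifferentiableAt ℝ W₁ p := h₁.differentiableAt (by simp)
  have d₂ : DifferentiableAt ℝ W₂ p := h₂.differentiableAt (by simp)
  have hxx : pdx (pdx W₁) p = pdx (pdy W₂) p +
      ((deriv (deriv f0) p.1 / f0 p.1 - a p.1 ^ 2) * W₁ p + a p.1 * pdx W₁ p) +
      b * pdx W₂ p := by
    rw [pdx_congr (Filter.mem_of_superset hΩ fun q hq => (hsys q hq).1)]
    exact ((h₂.differentiableAt_pdy.hasDerivAt_pdx.add
      ((hf0.hasDerivAt_deriv_div_self (hf0ne p.1)).mul d₁.hasDerivAt_pdx)).add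
      (d₂.hasDerivAt_pdx.const_mul b)).deriv
  have hyy : pdy (pdy W₁) p = b * pdy W₁ p - a p.1 * pdy W₂ p - pdy (pdx W₂) p := by
    rw [pdy_congr (Filter.mem_of_superset hΩ fun q hq => (hsys q hq).2)]
    exact (((d₁.hasDerivAt_pdy.const_mul b).sub (d₂.hasDerivAt_pdy.const_mul (a p.1))).sub
      h₂.differentiableAt_pdx.hasDerivAt_pdy).deriv
  have hν0 : deriv (deriv f0) p.1 / f0 p.1 = ν p.1 := by
    rw [div_eq_iff (hf0ne p.1)]
    linear_combination -hODE p.1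
  have hb2 : b ^ 2 = -ω ^ 2 := by
    rw [hb, mul_pow, Complex.I_sq]
    ring
  rw [hν0] at hxx
  rw [lap, hxx, hyy, h₂.pdx_pdy_comm]
  linear_combination -a p.1 * (hsys p hp).1 - b * (hsys p hp).2 - W₁ p * hb2
end
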